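/- arXiv:1212.6466 — 3 statements merged into one kernel-verified Lean document; each statement's English description precedes it below -/
import Mathlib

section
/- Let G be a 3-connected 1-heavy graph on n vertices. If for every induced copy H of Z_1 in G and every pair of vertices u, v at distance 2 within H, either max{deg_G(u), deg_G(v)} ≥ n/2 or |N_G(u) ∩ N_G(v)| ≥ 2, then G is Hamiltonian. -/
open SimpleGraph

/-- `G` is 2-connected: at least 3 vertices and deleting any single vertex leaves
a connected graph. -/
def TwoConnected {V : Type*} [Fintype V] (G : SimpleGraph V) : Prop :=
  3 ≤ Fintype.card V ∧ ∀ v : V, (G.induce {w | w ≠ v}).Connected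

/-- `c, a, b, d` form an induced claw (`K_{1,3}`) in `G` with center `c` and
end-vertices `a`, `b`, `d`. -/
def IsInducedClaw {V : Type*} (G : SimpleGraph V) (c a b d : V) : Prop :=
  a ≠ b ∧ a ≠ d ∧ b ≠ d ∧
  G.Adj c a ∧ G.Adj c b ∧ G.Adj c d ∧
  ¬G.Adj a b ∧ ¬G.Adj a d ∧ ¬G.Adj b d

/-- `a₁, a₂, a₃, b₁` form an induced copy of `Z₁` in `G`: triangle `a₁a₂a₃` with
pendant edge `a₁b₁`. -/
def IsInducedZ1 {V : Type*} (G : SimpleGraph V) (a1 a2 a3 b1 : V) : Prop :=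
  G.Adj a1 a2 ∧ G.Adj a1 a3 ∧ G.Adj a2 a3 ∧ G.Adj a1 b1 ∧
  b1 ≠ a2 ∧ b1 ≠ a3 ∧ ¬G.Adj b1 a2 ∧ ¬G.Adj b1 a3

/-- `a₁, a₂, a₃, b₁, c₁` form an induced copy of `Z₂` in `G`: triangle `a₁a₂a₃`
with path `a₁b₁c₁` attached at `a₁`. -/
def IsInducedZ2 {V : Type*} (G : SimpleGraph V) (a1 a2 a3 b1 c1 : V) : Prop :=
  G.Adj a1 a2 ∧ G.Adj a1 a3 ∧ G.Adj a2 a3 ∧ G.Adj a1 b1 ∧ G.Adj b1 c1 ∧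
  b1 ≠ a2 ∧ b1 ≠ a3 ∧ c1 ≠ a1 ∧ c1 ≠ a2 ∧ c1 ≠ a3 ∧
  ¬G.Adj b1 a2 ∧ ¬G.Adj b1 a3 ∧ ¬G.Adj c1 a1 ∧ ¬G.Adj c1 a2 ∧ ¬G.Adj c1 a3
/-- A vertex is heavy if its degree is at least `n/2`. -/
def Heavy {V : Type*} [Fintype V] (G : SimpleGraph V) [DecidableRel G.Adj] (v : V) : Prop :=
  Fintype.card V ≤ 2 * G.degree v

/-- `G` is 1-heavy: every induced claw has at least one heavy end-vertex. -/
def OneHeavy {V : Type*} [Fintype V] (G : SimpleGraph V) [DecidableRel G.Adj] : Prop :=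
  ∀ c a b d : V, IsInducedClaw G c a b d → Heavy G a ∨ Heavy G b ∨ Heavy G d

/-- `G` is 2-heavy: every induced claw has at least two heavy end-vertices. -/
def TwoHeavy {V : Type*} [Fintype V] (G : SimpleGraph V) [DecidableRel G.Adj] : Prop :=
  ∀ c a b d : V, IsInducedClaw G c a b d →
    (Heavy G a ∧ Heavy G b) ∨ (Heavy G a ∧ Heavy G d) ∨ (Heavy G b ∧ Heavy G d)

/-- `G` is o-heavy: every induced claw has two end-vertices with degree sum
at least `n`. -/
def OHeavy {V : Type*} [Fintype V] (G : SimpleGraph V) [DecidableRel G.Adj] : Prop :=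
  ∀ c a b d : V, IsInducedClaw G c a b d →
    Fintype.card V ≤ G.degree a + G.degree b ∨
    Fintype.card V ≤ G.degree a + G.degree d ∨
    Fintype.card V ≤ G.degree b + G.degree d

/-- The pair `u, v` satisfies Fan's condition (`max{d(u),d(v)} ≥ n/2`) or Shi's
condition (`|N(u) ∩ N(v)| ≥ 2`). -/
def FanOrShi {V : Type*} [Fintype V] [DecidableEq V]
    (G : SimpleGraph V) [DecidableRel G.Adj] (u v : V) : Prop :=
  Fintype.card V ≤ 2 * G.degree u ∨ Fintype.card V ≤ 2 * G.degree v ∨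
  2 ≤ (G.neighborFinset u ∩ G.neighborFinset v).card
/-- `G` is 3-connected: at least 4 vertices and deleting any two (not
necessarily distinct) vertices leaves a connected graph. -/
def ThreeConnected {V : Type*} [Fintype V] (G : SimpleGraph V) : Prop :=
  4 ≤ Fintype.card V ∧ ∀ u v : V, (G.induce {w | w ≠ u ∧ w ≠ v}).Connected


set_option linter.unusedSectionVars false

section PathOn

variable {V : Type*} [DecidableEq V]

/-- `PathOn G a b S`: there is a path of `G` from `a` to `b` with vertex set exactly `S`. -/
inductive PathOn (G : SimpleGraph V) : V → V → Finset V → Prop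
  | single (a : V) : PathOn G a a {a}
  | cons {a b d : V} {S : Finset V} :
      G.Adj a b → PathOn G b d S → a ∉ S → PathOn G a d (insert a S)

/-- There is a cycle of `G` with vertex set exactly `S`. -/
def CycleOn (G : SimpleGraph V) (S : Finset V) : Prop :=
  3 ≤ S.card ∧ ∃ a b, PathOn G a b S ∧ G.Adj b a

namespace PathOn

variable {G K : SimpleGraph V} {a b d e : V} {S T : Finset V}

theorem mono (hGK : G ≤ K) (h : PathOn G a b S) : PathOn K a b S := by
  induction h with
  | single a => exact .single a
  | cons h _ hn ih => exact .cons (hGK h) ih hn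

theorem left_mem (h : PathOn G a b S) : a ∈ S := by
  cases h <;> simp

theorem right_mem (h : PathOn G a b S) : b ∈ S := by
  induction h with
  | single a => simp
  | cons _ _ _ ih => exact Finset.mem_insert_of_mem ih

theorem append (h : PathOn G a b S) (hbd : G.Adj b d) (h' : PathOn G d e T)
    (hST : Disjoint S T) : PathOn G a e (S ∪ T) := by
  induction h with
  | single a =>
    rw [← Finset.insert_eq]
    exact .cons hbd h' (by simpa using hST)
  | cons hab _ hn ih =>
    rw [Finset.disjoint_insert_left] at hST
    rw [Finset.insert_union]
    exact .cons hab (ih hbd hST.2) (by simp [hn, hST.1])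

theorem reverse (h : PathOn G a b S) : PathOn G b a S := by
  induction h with
  | single a => exact .single a
  | @cons a b d S hab _ hn ih =>
    have := ih.append hab.symm (.single a) (by simpa using hn)
    rwa [Finset.union_comm, ← Finset.insert_eq] at this

theorem exists_walk (h : PathOn G a b S) :
    ∃ p : G.Walk a b, p.IsPath ∧ ∀ v, v ∈ p.support ↔ v ∈ S := by
  induction h with
  | single a => exact ⟨.nil, by simp, by simp⟩
  | cons hab _ hn ih =>
    obtain ⟨p, hp, hS⟩ := ih
    exact ⟨.cons hab p, by simp [hp, hS, hn], by simp [hS]⟩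

theorem exists_fun (h : PathOn G a b S) :
    ∃ (m : ℕ) (f : ℕ → V), f 0 = a ∧ f m = b ∧ S.card = m + 1 ∧
      (∀ i < m, G.Adj (f i) (f (i + 1))) ∧
      (∀ i ≤ m, ∀ j ≤ m, f i = f j → i = j) ∧ ∀ v, v ∈ S ↔ ∃ i ≤ m, f i = v := by
  induction h with
  | single a => exact ⟨0, fun _ => a, by simp [eq_comm]⟩
  | @cons a b d S hab _ hn ih =>
    obtain ⟨m, f, h0, hm, hc, hadj, hinj, hS⟩ := ih
    have hne : ∀ i ≤ m, f i ≠ a := fun i hi h => hn ((hS a).2 ⟨i, hi, h⟩)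
    refine ⟨m + 1, fun i => i.casesOn a f, rfl, hm, by simp [hn, hc], ?_, ?_, ?_⟩
    · rintro (_ | i) hi
      · simpa [h0] using hab
      · exact hadj i (by omega)
    · rintro (_ | i) hi (_ | j) hj hij
      · rfl
      · exact absurd hij.symm (hne j (by omega))
      · exact absurd hij (hne i (by omega))
      · rw [hinj i (by omega) j (by omega) hij]
    · intro v
      rw [Finset.mem_insert, hS]
      constructor
      · rintro (rfl | ⟨i, hi, rfl⟩)
        · exact ⟨0, by omega, rfl⟩
        · exact ⟨i + 1, by omega, rfl⟩
      · rintro ⟨_ | i, hi, rfl⟩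
        · exact .inl rfl
        · exact .inr ⟨i, by omega, rfl⟩

theorem of_walk {a b : V} (p : G.Walk a b) (hp : p.IsPath) :
    PathOn G a b p.support.toFinset := by
  induction p with
  | nil => simpa using PathOn.single _
  | cons h p ih =>
    rw [Walk.cons_isPath_iff] at hp
    simpa using PathOn.cons h (ih hp.1) (by simpa using hp.2)

theorem map_val {s : Set V} {a b : s} {S : Finset s} (h : PathOn (G.induce s) a b S) :
    PathOn G (a : V) b (S.image Subtype.val) := by
  induction h with
  | single a => simpa using PathOn.single _
  | cons hab _ hn ih =>
    rw [Finset.image_insert]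
    exact .cons (by simpa using hab) ih (by simpa using hn)

theorem of_reachable_induce {s : Set V} {a b : s} (h : (G.induce s).Reachable a b) :
    ∃ S : Finset V, PathOn G (a : V) b S ∧ ∀ v ∈ S, v ∈ s := by
  obtain ⟨p, hp⟩ := h.exists_isPath
  refine ⟨_, (of_walk p hp).map_val, fun v hv => ?_⟩
  obtain ⟨w, -, rfl⟩ := Finset.mem_image.1 hv
  exact w.2

theorem of_isClique (hS : G.IsClique S) (hne : S.Nonempty) : ∃ a b, PathOn G a b S := by
  induction hne using Finset.Nonempty.cons_induction with
  | singleton a => exact ⟨a, a, .single a⟩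
  | cons a S ha _ ih =>
    obtain ⟨b, d, h⟩ := ih (hS.subset (by simp))
    rw [Finset.cons_eq_insert]
    refine ⟨a, d, .cons (hS (by simp) (by simp [h.left_mem]) ?_) h ha⟩
    rintro rfl
    exact ha h.left_mem

theorem eq_singleton (h : PathOn G a a S) : S = {a} := by
  cases h with
  | single => rfl
  | cons _ h hn => exact absurd h.right_mem hn

end PathOn

/-- `c` lists the vertices of a cycle of `G` of length `m`, periodically in both directions. -/
structure IsCyclicOrder (G : SimpleGraph V) (m : ℕ) (c : ℤ → V) : Prop where
  three_le : 3 ≤ m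
  periodic : ∀ i, c (i + m) = c i
  adj : ∀ i, G.Adj (c i) (c (i + 1))
  dvd_of_eq : ∀ i j, c i = c j → (m : ℤ) ∣ i - j

theorem CycleOn.exists_isCyclicOrder {G : SimpleGraph V} {S : Finset V} (h : CycleOn G S) :
    ∃ (m : ℕ) (c : ℤ → V), IsCyclicOrder G m c ∧ ∀ v, v ∈ S ↔ ∃ i, c i = v := by
  obtain ⟨h3, a, b, hab, hba⟩ := h
  obtain ⟨m, f, h0, hm, hc, hadj, hinj, hS⟩ := hab.exists_fun
  have hpos : (0 : ℤ) < (m : ℤ) + 1 := by omega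
  have hmod : ∀ i : ℤ, ∃ k ≤ m, (i % ((m + 1 : ℕ) : ℤ)) = k := fun i =>
    ⟨(i % ((m + 1 : ℕ) : ℤ)).toNat, by
      have := Int.emod_lt_of_pos i hpos
      have := Int.emod_nonneg i hpos.ne'
      push_cast
      omega, by
      have := Int.emod_nonneg i hpos.ne'
      push_cast
      omega⟩
  refine ⟨m + 1, fun i => f (i % ((m + 1 : ℕ) : ℤ)).toNat, ⟨by omega, ?_, ?_, ?_⟩, ?_⟩
  · intro i
    simp
  · intro i
    obtain ⟨k, hk, hki⟩ := hmod i
    have hs : (i + 1) % ((m + 1 : ℕ) : ℤ) = ((k : ℤ) + 1) % ((m + 1 : ℕ) : ℤ) := by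
      rw [← hki, Int.emod_add_emod]
    simp only [hs, hki, Int.toNat_natCast]
    rcases hk.lt_or_eq with h | rfl
    · rw [Int.emod_eq_of_lt (by omega) (by push_cast; omega)]
      exact hadj k h
    · simpa [h0, hm] using hba
  · intro i j hij
    obtain ⟨k, hk, hki⟩ := hmod i
    obtain ⟨l, hl, hlj⟩ := hmod j
    simp only [hki, hlj, Int.toNat_natCast] at hij
    have := hinj k hk l hl hij
    exact Int.ModEq.dvd (show j % _ = i % _ by rw [hki, hlj, this])
  · intro v
    rw [hS]
    constructor
    · rintro ⟨k, hk, rfl⟩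
      refine ⟨k, ?_⟩
      dsimp only
      rw [Int.emod_eq_of_lt (by omega) (by push_cast; omega), Int.toNat_natCast]
    · rintro ⟨i, rfl⟩
      obtain ⟨k, hk, hki⟩ := hmod i
      exact ⟨k, hk, by simp only [hki, Int.toNat_natCast]⟩

/-- The set of entries of `c` with index between `a` and `b`. -/
noncomputable def arc (c : ℤ → V) (a b : ℤ) : Finset V := (Finset.Icc a b).image c

theorem mem_arc {c : ℤ → V} {a b i : ℤ} (ha : a ≤ i) (hb : i ≤ b) : c i ∈ arc c a b :=
  Finset.mem_image_of_mem c (Finset.mem_Icc.2 ⟨ha, hb⟩)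

theorem notMem_arc {c : ℤ → V} {x : V} (hx : ∀ i, c i ≠ x) (a b : ℤ) : x ∉ arc c a b := by
  simp [arc, hx]

theorem disjoint_arc_of_forall {c : ℤ → V} {S : Finset V} (hS : ∀ x ∈ S, ∀ i, c i ≠ x)
    (a b : ℤ) : Disjoint S (arc c a b) :=
  Finset.disjoint_left.2 fun x hx => notMem_arc (hS x hx) a b

namespace IsCyclicOrder

variable {G : SimpleGraph V} {m : ℕ} {c : ℤ → V}

theorem ne (hc : IsCyclicOrder G m c) {i j : ℤ} (hij : i < j) (hji : j < i + m) :
    c i ≠ c j := by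
  intro h
  have := Int.le_of_dvd (by omega) (hc.dvd_of_eq j i h.symm)
  omega

theorem shift (hc : IsCyclicOrder G m c) (s : ℤ) : IsCyclicOrder G m fun i => c (i + s) where
  three_le := hc.three_le
  periodic i := by rw [add_right_comm, hc.periodic]
  adj i := by rw [add_right_comm]; exact hc.adj _
  dvd_of_eq i j h := by simpa using hc.dvd_of_eq _ _ h

theorem reverse (hc : IsCyclicOrder G m c) : IsCyclicOrder G m fun i => c (-i) where
  three_le := hc.three_le
  periodic i := by rw [← hc.periodic]; congr 1; ring
  adj i := by
    have := (hc.adj (-(i + 1))).symm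
    rwa [show -(i + 1) + 1 = -i by ring] at this
  dvd_of_eq i j h := by
    have := hc.dvd_of_eq _ _ h.symm
    rwa [show -j - -i = i - j by ring] at this

theorem exists_index (hc : IsCyclicOrder G m c) (a i : ℤ) :
    ∃ j, a ≤ j ∧ j < a + m ∧ c j = c i := by
  have hm : (0 : ℤ) < m := by have := hc.three_le; omega
  have hp : ∀ (n : ℤ) i, c (i + n * m) = c i := by
    have : Function.Periodic c (m : ℤ) := hc.periodic
    intro n i
    simpa using this.int_mul n i
  refine ⟨a + (i - a) % m, ?_, ?_, ?_⟩
  · have := Int.emod_nonneg (i - a) hm.ne'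
    omega
  · have := Int.emod_lt_of_pos (i - a) hm
    omega
  · rw [← hp ((i - a) / m)]
    congr 1
    have := Int.emod_add_mul_ediv (i - a) m
    linarith [mul_comm ((i - a) / (m : ℤ)) (m : ℤ)]

theorem forall_mem (hc : IsCyclicOrder G m c) (a : ℤ) {S : Finset V}
    (h : ∀ i, a ≤ i → i < a + m → c i ∈ S) (i : ℤ) : c i ∈ S := by
  obtain ⟨j, h1, h2, h3⟩ := hc.exists_index a i
  exact h3 ▸ h j h1 h2

theorem disjoint_arc (hc : IsCyclicOrder G m c) {a b d e : ℤ} (hbd : b < d) (hea : e < a + m) :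
    Disjoint (arc c a b) (arc c d e) := by
  refine Finset.disjoint_left.2 fun x hx hx' => ?_
  obtain ⟨i, hi, rfl⟩ := Finset.mem_image.1 hx
  obtain ⟨j, hj, hji⟩ := Finset.mem_image.1 hx'
  rw [Finset.mem_Icc] at hi hj
  exact hc.ne (by omega) (by omega) hji.symm

theorem pathOn_arc_of_adj {a b : ℤ} (hab : a ≤ b)
    (hadj : ∀ i, a ≤ i → i < b → G.Adj (c i) (c (i + 1)))
    (hne : ∀ i j, a ≤ i → i < j → j ≤ b → c i ≠ c j) : PathOn G (c a) (c b) (arc c a b) := by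
  induction b, hab using Int.leInduction with
  | base => simpa [arc] using PathOn.single (c a)
  | succ b hab ih =>
    have h := (ih (fun i h h' => hadj i h (by omega))
      fun i j h h' h'' => hne i j h h' (by omega)).append (hadj b hab (by omega))
        (.single (c (b + 1))) (by
          simp only [arc, Finset.disjoint_singleton_right, Finset.mem_image, Finset.mem_Icc]
          rintro ⟨i, hi, h⟩
          exact hne i (b + 1) hi.1 (by omega) le_rfl h)
    convert h using 1
    ext v
    simp only [arc, Finset.mem_union, Finset.mem_image, Finset.mem_Icc, Finset.mem_singleton]
    constructor
    · rintro ⟨i, hi, rfl⟩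
      rcases lt_or_eq_of_le hi.2 with h | rfl
      · exact .inl ⟨i, by omega, rfl⟩
      · exact .inr rfl
    · rintro (⟨i, hi, rfl⟩ | rfl)
      · exact ⟨i, by omega, rfl⟩
      · exact ⟨b + 1, by omega, rfl⟩

theorem pathOn_arc (hc : IsCyclicOrder G m c) {a b : ℤ} (hab : a ≤ b) (hba : b < a + m) :
    PathOn G (c a) (c b) (arc c a b) :=
  pathOn_arc_of_adj hab (fun i _ _ => hc.adj i) fun _ _ _ h _ => hc.ne h (by omega)

theorem three_le_card (hc : IsCyclicOrder G m c) {S : Finset V} (h : ∀ i, c i ∈ S) :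
    3 ≤ S.card := by
  have h3 := hc.three_le
  exact Finset.two_lt_card.2 ⟨c 0, h 0, c 1, h 1, c 2, h 2, hc.ne (by omega) (by omega),
    hc.ne (by omega) (by omega), hc.ne (by omega) (by omega)⟩

theorem eq_of_dvd (hc : IsCyclicOrder G m c) {i j : ℤ} (h : (m : ℤ) ∣ i - j) : c i = c j := by
  obtain ⟨k, hk⟩ := h
  have : Function.Periodic c (m : ℤ) := hc.periodic
  rw [show i = j + k * m by linarith]
  simpa using this.int_mul k j

/-- The main step of the closure argument: the cycle uses the new edge `uv`. -/
theorem exists_cycleOn_of_new_edge [Fintype V] {K : SimpleGraph V} [DecidableRel K.Adj]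
    {u v : V} (hc : IsCyclicOrder (K ⊔ edge u v) m c) (hu : c 1 = u) (hv : c 0 = v)
    (hdeg : Fintype.card V ≤ K.degree u + K.degree v) :
    ∃ T, (∀ i, c i ∈ T) ∧ CycleOn K T := by
  subst hu hv
  have h3 := hc.three_le
  have hK : ∀ t : ℤ, 1 ≤ t → t < m → K.Adj (c t) (c (t + 1)) := by
    intro t h1 ht
    have h := hc.adj t
    rw [sup_adj, edge_adj] at h
    rcases h with h | ⟨⟨h, h'⟩ | ⟨h, h'⟩, -⟩
    · exact h
    · rcases h1.eq_or_lt with rfl | h1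
      · exact absurd h'.symm (hc.ne (by omega) (by omega))
      · exact absurd h.symm (hc.ne (by omega) (by omega))
    · exact absurd h.symm (hc.ne (by omega) (by omega))
  have hpath : ∀ a b : ℤ, 1 ≤ a → a ≤ b → b ≤ m → PathOn K (c a) (c b) (arc c a b) :=
    fun a b ha hab hb => pathOn_arc_of_adj hab
      (fun i h h' => hK i (by omega) (by omega)) fun i j h h' h'' => hc.ne h' (by omega)
  have hm0 : c m = c 0 := by simpa using hc.periodic 0
  classical
  let φ : V → V := fun y => if h : ∃ i, c i = y then c (h.choose - 1) else y
  have hφ : ∀ i, φ (c i) = c (i - 1) := by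
    intro i
    have h : ∃ j, c j = c i := ⟨i, rfl⟩
    simp only [φ, dif_pos h]
    apply hc.eq_of_dvd
    simpa using hc.dvd_of_eq _ _ h.choose_spec
  have hφ' : ∀ y, (¬ ∃ i, c i = y) → φ y = y := fun y h => dif_neg h
  have hinj : Function.Injective φ := by
    intro y z hyz
    by_cases hy : ∃ i, c i = y <;> by_cases hz : ∃ i, c i = z
    · obtain ⟨i, rfl⟩ := hy
      obtain ⟨j, rfl⟩ := hz
      rw [hφ, hφ] at hyz
      apply hc.eq_of_dvd
      simpa using hc.dvd_of_eq _ _ hyz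
    · obtain ⟨i, rfl⟩ := hy
      rw [hφ, hφ' z hz] at hyz
      exact absurd ⟨_, hyz⟩ hz
    · obtain ⟨i, rfl⟩ := hz
      rw [hφ, hφ' y hy] at hyz
      exact absurd ⟨_, hyz.symm⟩ hy
    · rwa [hφ' y hy, hφ' z hz] at hyz
  have hnot : ¬ Disjoint ((K.neighborFinset (c 1)).image φ) (K.neighborFinset (c 0)) := by
    intro hd
    have hsub : (K.neighborFinset (c 1)).image φ ∪ K.neighborFinset (c 0) ⊆
        Finset.univ.erase (c 0) := by
      intro y hy
      rw [Finset.mem_erase]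
      refine ⟨?_, Finset.mem_univ y⟩
      rintro rfl
      rw [Finset.mem_union, Finset.mem_image] at hy
      rcases hy with ⟨z, hz, hzy⟩ | hy
      · have : z = c 1 := hinj (by rw [hzy, hφ]; norm_num)
        subst this
        simp at hz
      · simp at hy
    have := Finset.card_le_card hsub
    rw [Finset.card_union_of_disjoint hd, Finset.card_image_of_injective _ hinj,
      Finset.card_erase_of_mem (Finset.mem_univ _), Finset.card_univ,
      card_neighborFinset_eq_degree, card_neighborFinset_eq_degree] at this
    have : 0 < Fintype.card V := Fintype.card_pos_iff.2 ⟨c 0⟩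
    omega
  obtain ⟨y, hy, hy'⟩ := Finset.not_disjoint_iff.1 hnot
  obtain ⟨z, hz, rfl⟩ := Finset.mem_image.1 hy
  rw [mem_neighborFinset] at hz hy'
  by_cases hzc : ∃ i, c i = z
  · obtain ⟨i₀, rfl⟩ := hzc
    obtain ⟨i, hi1, him, hi⟩ := hc.exists_index 1 i₀
    rw [← hi] at hz hy'
    rw [hφ] at hy'
    have hi2 : 2 ≤ i := by
      by_contra h
      obtain rfl : i = 1 := by omega
      simp at hz
    have hT := (hpath i m hi1 (by omega) le_rfl).append (hm0 ▸ hy')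
      (hpath 1 (i - 1) le_rfl (by omega) (by omega)).reverse
      (hc.disjoint_arc (by omega) (by omega)).symm
    have hmem : ∀ j, c j ∈ arc c i m ∪ arc c 1 (i - 1) := by
      refine hc.forall_mem 1 fun j h1 h2 => Finset.mem_union.2 ?_
      rcases le_or_gt i j with h | h
      · exact .inl (mem_arc h (by omega))
      · exact .inr (mem_arc h1 (by omega))
    exact ⟨_, hmem, hc.three_le_card hmem, _, _, hT, hz⟩
  · rw [hφ' z hzc] at hy'
    have hT := (hpath 1 m le_rfl (by omega) le_rfl).append (hm0 ▸ hy') (.single z)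
      (Finset.disjoint_singleton_right.2 (notMem_arc (fun i h => hzc ⟨i, h⟩) _ _))
    have hmem : ∀ j, c j ∈ arc c 1 m ∪ {z} :=
      hc.forall_mem 1 fun j h1 h2 => Finset.mem_union_left _ (mem_arc h1 (by omega))
    exact ⟨_, hmem, hc.three_le_card hmem, _, _, hT, hz.symm⟩

end IsCyclicOrder

theorem CycleOn.exists_of_sup_edge [Fintype V] {K : SimpleGraph V} [DecidableRel K.Adj] {u v : V}
    {S : Finset V} (h : CycleOn (K ⊔ edge u v) S)
    (hdeg : Fintype.card V ≤ K.degree u + K.degree v) : ∃ T, S ⊆ T ∧ CycleOn K T := by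
  obtain ⟨m, c, hc, hS⟩ := h.exists_isCyclicOrder
  have h3 := hc.three_le
  suffices ∃ T, (∀ i, c i ∈ T) ∧ CycleOn K T by
    obtain ⟨T, hT, hT'⟩ := this
    refine ⟨T, fun x hx => ?_, hT'⟩
    obtain ⟨i, rfl⟩ := (hS x).1 hx
    exact hT i
  by_cases hall : ∀ i, K.Adj (c i) (c (i + 1))
  · have hc' : IsCyclicOrder K m c := ⟨hc.three_le, hc.periodic, hall, hc.dvd_of_eq⟩
    have hmem : ∀ i, c i ∈ arc c 1 m :=
      hc.forall_mem 1 fun j h1 h2 => mem_arc h1 (by omega)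
    refine ⟨_, hmem, hc.three_le_card hmem, _, _, hc'.pathOn_arc (by omega) (by omega), ?_⟩
    have := hall m
    rwa [add_comm, hc.periodic] at this
  · push Not at hall
    obtain ⟨i, hi⟩ := hall
    have h := hc.adj i
    rw [sup_adj, edge_adj] at h
    rcases h with h | ⟨⟨h, h'⟩ | ⟨h, h'⟩, -⟩
    · exact absurd h hi
    · rw [edge_comm] at hc
      obtain ⟨T, hT, hcyc⟩ := (hc.shift i).exists_cycleOn_of_new_edge
        (by rw [add_comm, h']) (by rw [zero_add, h]) (by rwa [add_comm])
      exact ⟨T, fun j => by simpa using hT (j - i), hcyc⟩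
    · obtain ⟨T, hT, hcyc⟩ := (hc.shift i).exists_cycleOn_of_new_edge
        (by rw [add_comm, h']) (by rw [zero_add, h]) hdeg
      exact ⟨T, fun j => by simpa using hT (j - i), hcyc⟩

/-- `G` with all edges between vertices satisfying `H` added. -/
def joinOn (G : SimpleGraph V) (H : V → Prop) : SimpleGraph V where
  Adj a b := G.Adj a b ∨ a ≠ b ∧ H a ∧ H b
  symm := ⟨fun a b h => h.imp (fun h => h.symm) fun h => ⟨h.1.symm, h.2.2, h.2.1⟩⟩
  loopless := ⟨fun a h => by simp at h⟩

theorem le_joinOn (G : SimpleGraph V) (H : V → Prop) : G ≤ joinOn G H := fun _ _ => Or.inl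

theorem CycleOn.exists_of_joinOn [Fintype V] {G : SimpleGraph V} [DecidableRel G.Adj]
    {S : Finset V} (h : CycleOn (joinOn G (Heavy G)) S) : ∃ T, S ⊆ T ∧ CycleOn G T := by
  classical
  have key : ∀ F : Finset (V × V), (∀ p ∈ F, Heavy G p.1 ∧ Heavy G p.2) →
      ∀ S, CycleOn (G ⊔ F.sup fun p => edge p.1 p.2) S → ∃ T, S ⊆ T ∧ CycleOn G T := by
    intro F
    induction F using Finset.induction_on with
    | empty => exact fun _ S hS => ⟨S, subset_rfl, by simpa using hS⟩
    | insert p F hp ih =>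
      intro hF S hS
      rw [Finset.sup_insert, sup_comm (edge _ _), ← sup_assoc] at hS
      obtain ⟨h1, h2⟩ := hF p (by simp)
      have hle : ∀ v, G.degree v ≤ (G ⊔ F.sup fun p => edge p.1 p.2).degree v :=
        fun v => degree_le_of_le le_sup_left
      obtain ⟨T, hST, hT⟩ := hS.exists_of_sup_edge (by
        have := hle p.1
        have := hle p.2
        unfold Heavy at h1 h2
        omega)
      obtain ⟨U, hTU, hU⟩ := ih (fun q hq => hF q (by simp [hq])) T hT
      exact ⟨U, hST.trans hTU, hU⟩
  obtain ⟨h3, a, b, hab, hba⟩ := h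
  have hle : joinOn G (Heavy G) ≤ G ⊔ (Finset.univ.filter fun p : V × V =>
      Heavy G p.1 ∧ Heavy G p.2).sup fun p => edge p.1 p.2 := by
    rintro x y (h | ⟨hne, hx, hy⟩)
    · exact .inl h
    · refine Or.inr (Finset.le_sup (f := fun p : V × V => edge p.1 p.2)
        (b := (x, y)) (by simp [hx, hy]) ?_)
      simp [edge_adj, hne]
  exact key _ (by simp) S ⟨h3, a, b, hab.mono hle, hle hba⟩

end PathOn

section MaximalCycle

variable {V : Type*} [DecidableEq V] {G : SimpleGraph V} {H : V → Prop} {m : ℕ} {c : ℤ → V}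

theorem IsCyclicOrder.mono {K : SimpleGraph V} (hGK : G ≤ K) (hc : IsCyclicOrder G m c) :
    IsCyclicOrder K m c :=
  ⟨hc.three_le, hc.periodic, fun i => hGK (hc.adj i), hc.dvd_of_eq⟩

theorem IsCyclicOrder.add_eq_add (hc : IsCyclicOrder G m c) {i j : ℤ} (h : c i = c j) (t : ℤ) :
    c (i + t) = c (j + t) :=
  hc.eq_of_dvd (by simpa using hc.dvd_of_eq _ _ h)

theorem IsCyclicOrder.sub_one_ne_add_one (hc : IsCyclicOrder G m c) (i : ℤ) :
    c (i - 1) ≠ c (i + 1) :=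
  hc.ne (by omega) (by have := hc.three_le; omega)

theorem IsCyclicOrder.adj_sub_one (hc : IsCyclicOrder G m c) (i : ℤ) : G.Adj (c i) (c (i - 1)) := by
  simpa using (hc.adj (i - 1)).symm

/-- The cycle `c` of `G` contains all vertices satisfying `H`, and no cycle in the graph obtained
by joining these vertices properly extends its vertex set. -/
structure IsMaximalCycle (G : SimpleGraph V) (H : V → Prop) (m : ℕ) (c : ℤ → V) : Prop where
  isCyclicOrder : IsCyclicOrder G m c
  heavy_mem : ∀ v, H v → ∃ i, c i = v
  maximal : ∀ a b S, PathOn (joinOn G H) a b S → (joinOn G H).Adj b a → (∀ i, c i ∈ S) →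
    ∀ x ∈ S, ∃ i, c i = x

namespace IsMaximalCycle

variable {x y : V} {i j : ℤ}

theorem joined (hM : IsMaximalCycle G H m c) : IsCyclicOrder (joinOn G H) m c :=
  hM.isCyclicOrder.mono (le_joinOn G H)

theorem reverse (hM : IsMaximalCycle G H m c) : IsMaximalCycle G H m fun i => c (-i) where
  isCyclicOrder := hM.isCyclicOrder.reverse
  heavy_mem v hv := by
    obtain ⟨i, hi⟩ := hM.heavy_mem v hv
    exact ⟨-i, by simpa using hi⟩
  maximal a b S h hba hS x hx := by
    obtain ⟨i, hi⟩ := hM.maximal a b S h hba (fun i => by simpa using hS (-i)) x hx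
    exact ⟨-i, by simpa using hi⟩

theorem shift (hM : IsMaximalCycle G H m c) (s : ℤ) :
    IsMaximalCycle G H m fun i => c (i + s) where
  isCyclicOrder := hM.isCyclicOrder.shift s
  heavy_mem v hv := by
    obtain ⟨i, hi⟩ := hM.heavy_mem v hv
    exact ⟨i - s, by simpa using hi⟩
  maximal a b S h hba hS x hx := by
    obtain ⟨i, hi⟩ := hM.maximal a b S h hba (fun i => by simpa using hS (i - s)) x hx
    exact ⟨i - s, by simpa using hi⟩

theorem not_heavy (hM : IsMaximalCycle G H m c) (hx : ∀ i, c i ≠ x) : ¬ H x := fun h => by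
  obtain ⟨i, hi⟩ := hM.heavy_mem x h
  exact hx i hi

/-- Three arcs partitioning the cycle cannot be joined to a cycle through an outside vertex. -/
theorem false_of_three_arcs (hM : IsMaximalCycle G H m c) (hx : ∀ i, c i ≠ x)
    {a₁ b₁ a₂ b₂ a₃ b₃ : V} {i₁ j₁ i₂ j₂ i₃ j₃ : ℤ}
    (p₁ : PathOn (joinOn G H) a₁ b₁ (arc c i₁ j₁)) (p₂ : PathOn (joinOn G H) a₂ b₂ (arc c i₂ j₂))
    (p₃ : PathOn (joinOn G H) a₃ b₃ (arc c i₃ j₃)) (h₁ : (joinOn G H).Adj x a₁)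
    (h₂ : (joinOn G H).Adj b₁ a₂) (h₃ : (joinOn G H).Adj b₂ a₃) (h₄ : (joinOn G H).Adj b₃ x)
    (d₁₂ : j₁ < i₂ ∧ j₂ < i₁ + m ∨ j₂ < i₁ ∧ j₁ < i₂ + m)
    (d₁₃ : j₁ < i₃ ∧ j₃ < i₁ + m ∨ j₃ < i₁ ∧ j₁ < i₃ + m)
    (d₂₃ : j₂ < i₃ ∧ j₃ < i₂ + m ∨ j₃ < i₂ ∧ j₂ < i₃ + m) (s : ℤ)
    (hs : ∀ t, s ≤ t → t < s + m → i₁ ≤ t ∧ t ≤ j₁ ∨ i₂ ≤ t ∧ t ≤ j₂ ∨ i₃ ≤ t ∧ t ≤ j₃) :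
    False := by
  have hd : ∀ {i j k l : ℤ}, j < k ∧ l < i + m ∨ l < i ∧ j < k + m →
      Disjoint (arc c i j) (arc c k l) := by
    rintro i j k l (⟨h, h'⟩ | ⟨h, h'⟩)
    · exact hM.joined.disjoint_arc h h'
    · exact (hM.joined.disjoint_arc h h').symm
  have hx' : ∀ i j, Disjoint {x} (arc c i j) := disjoint_arc_of_forall (by simpa using hx)
  have h := (PathOn.single x).append h₁ (p₁.append h₂ (p₂.append h₃ p₃ (hd d₂₃))
    (Finset.disjoint_union_right.2 ⟨hd d₁₂, hd d₁₃⟩))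
    (by simp only [Finset.disjoint_union_right, hx', and_self])
  obtain ⟨i, hi⟩ := hM.maximal _ _ _ h h₄ (hM.joined.forall_mem s fun t h1 h2 => by
    simp only [Finset.mem_union]
    rcases hs t h1 h2 with h | h | h
    · exact .inr (.inl (mem_arc h.1 h.2))
    · exact .inr (.inr (.inl (mem_arc h.1 h.2)))
    · exact .inr (.inr (.inr (mem_arc h.1 h.2)))) x (by simp)
  exact hx i hi

section Detour

variable {S : Finset V}

theorem not_adj_add_one_add_one (hM : IsMaximalCycle G H m c) (hS : ∀ z ∈ S, ∀ i, c i ≠ z)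
    (hp : PathOn G x y S) (hxi : G.Adj x (c i)) (hyj : G.Adj y (c j)) (hij : c i ≠ c j) :
    ¬ (joinOn G H).Adj (c (i + 1)) (c (j + 1)) := by
  intro h
  have hle := le_joinOn G H
  obtain ⟨k, hik, hki, hkj⟩ := hM.joined.exists_index i j
  rw [← hM.joined.add_eq_add hkj] at h
  rw [← hkj] at hyj hij
  have hne : i ≠ k := by rintro rfl; exact hij rfl
  have hpath := (hp.mono hle).append (hle hyj)
    ((hM.joined.pathOn_arc (a := i + 1) (b := k) (by omega) (by omega)).reverse.append h
      (hM.joined.pathOn_arc (a := k + 1) (b := i + m) (by omega) (by omega))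
      (hM.joined.disjoint_arc (by omega) (by omega)))
    (Finset.disjoint_union_right.2 ⟨disjoint_arc_of_forall hS _ _, disjoint_arc_of_forall hS _ _⟩)
  obtain ⟨l, hl⟩ := hM.maximal _ _ _ hpath
    (by rw [hM.joined.periodic]; exact hle hxi.symm)
    (hM.joined.forall_mem (i + 1) fun t h1 h2 => by
      simp only [Finset.mem_union]
      rcases le_or_gt t k with h | h
      · exact .inr (.inl (mem_arc h1 h))
      · exact .inr (.inr (mem_arc h (by omega)))) x (by simp [hp.left_mem])
  exact hS x hp.left_mem l hl

theorem not_adj_sub_one_sub_one (hM : IsMaximalCycle G H m c) (hS : ∀ z ∈ S, ∀ i, c i ≠ z)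
    (hp : PathOn G x y S) (hxi : G.Adj x (c i)) (hyj : G.Adj y (c j)) (hij : c i ≠ c j) :
    ¬ (joinOn G H).Adj (c (i - 1)) (c (j - 1)) := by
  have h := hM.reverse.not_adj_add_one_add_one (i := -i) (j := -j) (fun z hz i => hS z hz _) hp
    (by simpa using hxi) (by simpa using hyj) (by simpa using hij)
  simpa [sub_eq_add_neg, add_comm] using h

theorem not_heavy_add_one_add_one (hM : IsMaximalCycle G H m c) (hS : ∀ z ∈ S, ∀ i, c i ≠ z)
    (hp : PathOn G x y S) (hxi : G.Adj x (c i)) (hyj : G.Adj y (c j)) (hij : c i ≠ c j) :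
    ¬ (H (c (i + 1)) ∧ H (c (j + 1))) := fun h =>
  hM.not_adj_add_one_add_one hS hp hxi hyj hij <| .inr
    ⟨fun he => hij (by simpa using hM.joined.add_eq_add he (-1)), h.1, h.2⟩

theorem not_heavy_sub_one_sub_one (hM : IsMaximalCycle G H m c) (hS : ∀ z ∈ S, ∀ i, c i ≠ z)
    (hp : PathOn G x y S) (hxi : G.Adj x (c i)) (hyj : G.Adj y (c j)) (hij : c i ≠ c j) :
    ¬ (H (c (i - 1)) ∧ H (c (j - 1))) := fun h =>
  hM.not_adj_sub_one_sub_one hS hp hxi hyj hij <| .inr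
    ⟨fun he => hij (by simpa using hM.joined.add_eq_add he 1), h.1, h.2⟩

theorem not_adj_of_pathOn (hM : IsMaximalCycle G H m c) (hS : ∀ z ∈ S, ∀ i, c i ≠ z)
    (hp : PathOn G x y S) (hxi : G.Adj x (c i)) : ¬ G.Adj y (c (i + 1)) := fun hy =>
  hM.not_adj_add_one_add_one hS hp.reverse hy hxi (hM.joined.adj i).ne.symm
    (hM.joined.adj (i + 1)).symm

end Detour

theorem not_adj_add_one (hM : IsMaximalCycle G H m c) (hx : ∀ i, c i ≠ x)
    (hxi : G.Adj x (c i)) : ¬ G.Adj x (c (i + 1)) :=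
  hM.not_adj_of_pathOn (by simpa using hx) (.single x) hxi

theorem not_adj_sub_one (hM : IsMaximalCycle G H m c) (hx : ∀ i, c i ≠ x)
    (hxi : G.Adj x (c i)) : ¬ G.Adj x (c (i - 1)) := fun h =>
  hM.not_adj_add_one hx h (by simpa using hxi)

theorem not_adj_around (hM : IsMaximalCycle G H m c) (hx : ∀ i, c i ≠ x)
    (hxi : G.Adj x (c i)) (hxj : G.Adj x (c j)) (hij : c i ≠ c j)
    (hji : G.Adj (c j) (c (i + 1))) : ¬ (joinOn G H).Adj (c (j - 1)) (c (j + 1)) := by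
  intro h
  have hle := le_joinOn G H
  obtain ⟨k, hik, hki, hkj⟩ := hM.joined.exists_index i j
  have hsub := hM.joined.add_eq_add hkj (-1)
  simp only [← sub_eq_add_neg] at hsub
  rw [← hM.joined.add_eq_add hkj, ← hsub] at h
  rw [← hkj] at hxj hij hji
  have h1 : k ≠ i := by rintro rfl; exact hij rfl
  have h2 : k ≠ i + 1 := by rintro rfl; exact hM.not_adj_add_one hx hxi hxj
  have h3 : k ≠ i + m - 1 := by
    rintro rfl
    rw [add_sub_right_comm, hM.joined.periodic] at hxj
    exact hM.not_adj_sub_one hx hxi hxj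
  exact hM.false_of_three_arcs hx (hM.joined.pathOn_arc (a := k) (b := k) le_rfl (by omega))
    (hM.joined.pathOn_arc (a := i + 1) (b := k - 1) (by omega) (by omega))
    (hM.joined.pathOn_arc (a := k + 1) (b := i + m) (by omega) (by omega))
    (hle hxj) (hle hji) h (by rw [hM.joined.periodic]; exact hle hxi.symm)
    (by omega) (by omega) (by omega) (i + 1) (by omega)

theorem not_adj_around_of_sub_one (hM : IsMaximalCycle G H m c) (hx : ∀ i, c i ≠ x)
    (hxi : G.Adj x (c i)) (hxj : G.Adj x (c j)) (hij : c i ≠ c j)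
    (hji : G.Adj (c j) (c (i - 1))) : ¬ (joinOn G H).Adj (c (j - 1)) (c (j + 1)) := fun h => by
  refine hM.reverse.not_adj_around (x := x) (i := -i) (j := -j) (fun i => hx _) (by simpa using hxi)
    (by simpa using hxj) (by simpa using hij) (by simpa [sub_eq_add_neg, add_comm] using hji) ?_
  simpa [sub_eq_add_neg, add_comm] using h.symm

theorem adj_of_not_heavy (hM : IsMaximalCycle G H m c) (hx : ∀ i, c i ≠ x)
    (hclaw : ∀ z a b d, IsInducedClaw G z a b d → H a ∨ H b ∨ H d)
    {z : V} (hxz : G.Adj x z) {a b : V} (hza : G.Adj z a)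
    (hzb : G.Adj z b) (hxa : ¬ G.Adj x a) (hxb : ¬ G.Adj x b) (hab : a ≠ b)
    (hac : ∃ i, c i = a) (hbc : ∃ i, c i = b) (ha : ¬ H a) (hb : ¬ H b) : G.Adj a b := by
  by_contra h
  obtain ⟨i, rfl⟩ := hac
  obtain ⟨j, rfl⟩ := hbc
  have := hclaw z x _ _ ⟨(hx i).symm, (hx j).symm, hab, hxz.symm, hza, hzb, hxa, hxb, h⟩
  have := hM.not_heavy hx
  tauto

theorem exists_common (hM : IsMaximalCycle G H m c) (hx : ∀ i, c i ≠ x)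
    (hZ : ∀ a₁ a₂ a₃ b₁, IsInducedZ1 G a₁ a₂ a₃ b₁ → ¬ H a₂ → ¬ H b₁ →
      ∃ y, y ≠ a₁ ∧ G.Adj a₂ y ∧ G.Adj b₁ y)
    (hxi : G.Adj x (c i)) {k : ℤ} (hj : j = i + 1 ∨ j = i - 1)
    (hik : G.Adj (c i) (c k)) (hjk : G.Adj (c j) (c k)) (hxk : ¬ G.Adj x (c k))
    (hlight : ¬ H (c j)) : ∃ l, c l ≠ c i ∧ G.Adj (c j) (c l) ∧ G.Adj x (c l) := by
  have hij : G.Adj (c i) (c j) := by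
    rcases hj with rfl | rfl
    · exact hM.isCyclicOrder.adj i
    · exact hM.isCyclicOrder.adj_sub_one i
  have hxj : ¬ G.Adj x (c j) := by
    rcases hj with rfl | rfl
    · exact hM.not_adj_add_one hx hxi
    · exact hM.not_adj_sub_one hx hxi
  obtain ⟨y, hyi, hjy, hxy⟩ := hZ (c i) (c j) (c k) x
    ⟨hij, hik, hjk, hxi.symm, (hx j).symm, (hx k).symm, hxj, hxk⟩ hlight (hM.not_heavy hx)
  by_cases hy : ∃ l, c l = y
  · obtain ⟨l, rfl⟩ := hy
    exact ⟨l, hyi, hjy, hxy⟩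
  · push Not at hy
    have hp : PathOn G x y {x, y} := .cons hxy (.single y) (by simpa using hxy.ne)
    have hS : ∀ z ∈ ({x, y} : Finset V), ∀ i, c i ≠ z := by
      simp only [Finset.mem_insert, Finset.mem_singleton]
      rintro z (rfl | rfl)
      exacts [hx, hy]
    rcases hj with rfl | rfl
    · exact absurd hjy.symm (hM.not_adj_of_pathOn hS hp hxi)
    · exact absurd (by simpa using hxi) (hM.not_adj_of_pathOn hS hp.reverse hjy.symm)

theorem exists_heavy_add_one (hM : IsMaximalCycle G H m c) (hx : ∀ i, c i ≠ x)
    (hclaw : ∀ z a b d, IsInducedClaw G z a b d → H a ∨ H b ∨ H d)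
    (hZ : ∀ a₁ a₂ a₃ b₁, IsInducedZ1 G a₁ a₂ a₃ b₁ → ¬ H a₂ → ¬ H b₁ →
      ∃ y, y ≠ a₁ ∧ G.Adj a₂ y ∧ G.Adj b₁ y)
    (hx0 : G.Adj x (c 0)) (h1 : ¬ H (c 1))
    (hadj : G.Adj (c 1) (c (-1))) :
    ∃ j : ℤ, 3 ≤ j ∧ j ≤ m - 2 ∧ G.Adj x (c j) ∧ G.Adj (c 1) (c j) ∧ G.Adj (c 1) (c (j - 1)) ∧
      H (c (j + 1)) ∧ ¬ H (c (j - 1)) := by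
  have hle := le_joinOn G H
  have hc := hM.isCyclicOrder
  have h3 := hc.three_le
  have hx1 : ¬ G.Adj x (c 1) := hM.not_adj_add_one hx hx0
  have hx1' : ¬ G.Adj x (c (-1)) := hM.not_adj_sub_one hx hx0
  obtain ⟨l, hl0, hl1, hxl⟩ := hM.exists_common hx hZ (i := 0) (j := 1) (k := -1) hx0 (by simp)
    (by simpa using hc.adj_sub_one 0) hadj hx1' h1
  obtain ⟨j, hj0, hjm, hjl⟩ := hc.exists_index 0 l
  rw [← hjl] at hl0 hl1 hxl
  have hj0' : j ≠ 0 := by rintro rfl; exact hl0 rfl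
  have hj1 : j ≠ 1 := by rintro rfl; exact hx1 hxl
  have hjm1 : j ≠ m - 1 := by
    rintro rfl
    rw [show (m : ℤ) - 1 = -1 + m by ring, hc.periodic] at hxl
    exact hx1' hxl
  have hj2 : j ≠ 2 := by
    rintro rfl
    refine hM.false_of_three_arcs hx
      (hM.joined.pathOn_arc (a := 2) (b := m - 1) (by omega) (by omega))
      (hM.joined.pathOn_arc (a := 1) (b := 1) (by omega) (by omega))
      (hM.joined.pathOn_arc (a := 0) (b := 0) (by omega) (by omega))
      (hle hxl) (hle ?_) (hle (hc.adj 0).symm) (hle hx0.symm) (by omega) (by omega) (by omega) 0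
      (by omega)
    rw [show (m : ℤ) - 1 = -1 + m by ring, hc.periodic]
    exact hadj.symm
  have haround := hM.not_adj_around hx hx0 hxl hl0.symm hl1.symm
  have hsucc : ¬ G.Adj (c 1) (c (j + 1)) := fun h =>
    hM.not_adj_add_one_add_one (i := 0) (S := {x}) (by simpa using hx) (.single x) hx0 hxl hl0.symm
      (hle h)
  have hheavy : H (c (j + 1)) := by
    by_contra hn
    exact hsucc (hM.adj_of_not_heavy hx hclaw hxl hl1.symm (hc.adj j) hx1
      (hM.not_adj_add_one hx hxl) (hc.ne (by omega) (by omega)) ⟨_, rfl⟩ ⟨_, rfl⟩ h1 hn)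
  have hlight : ¬ H (c (j - 1)) := fun h => haround (.inr ⟨hc.sub_one_ne_add_one j, h, hheavy⟩)
  exact ⟨j, by omega, by omega, hxl, hl1, hM.adj_of_not_heavy hx hclaw hxl hl1.symm
    (hc.adj_sub_one j) hx1 (hM.not_adj_sub_one hx hxl) (hc.ne (by omega) (by omega))
    ⟨_, rfl⟩ ⟨_, rfl⟩ h1 hlight, hheavy, hlight⟩

theorem exists_heavy_sub_one (hM : IsMaximalCycle G H m c) (hx : ∀ i, c i ≠ x)
    (hclaw : ∀ z a b d, IsInducedClaw G z a b d → H a ∨ H b ∨ H d)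
    (hZ : ∀ a₁ a₂ a₃ b₁, IsInducedZ1 G a₁ a₂ a₃ b₁ → ¬ H a₂ → ¬ H b₁ →
      ∃ y, y ≠ a₁ ∧ G.Adj a₂ y ∧ G.Adj b₁ y)
    (hx0 : G.Adj x (c 0)) (h1 : ¬ H (c (-1)))
    (hadj : G.Adj (c 1) (c (-1))) :
    ∃ k : ℤ, 2 ≤ k ∧ k ≤ m - 3 ∧ G.Adj x (c k) ∧ G.Adj (c (-1)) (c k) ∧
      G.Adj (c (-1)) (c (k + 1)) ∧ H (c (k - 1)) ∧ ¬ H (c (k + 1)) := by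
  obtain ⟨j, hj3, hjm, hxj, h1j, h1j', hh, hl⟩ := hM.reverse.exists_heavy_add_one
    (fun i => hx _) hclaw hZ (by simpa using hx0) h1 (by simpa using hadj.symm)
  have e : ∀ i, c (-i) = c (m - i) := fun i => by
    rw [← hM.joined.periodic, neg_add_eq_sub]
  simp only [e] at hxj h1j h1j' hh hl
  rw [← e 1] at h1j h1j'
  rw [show (m : ℤ) - (j - 1) = m - j + 1 by ring] at h1j' hl
  rw [show (m : ℤ) - (j + 1) = m - j - 1 by ring] at hh
  exact ⟨m - j, by omega, by omega, hxj, h1j, h1j', hh, hl⟩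

theorem false_of_not_heavy (hM : IsMaximalCycle G H m c) (hx : ∀ i, c i ≠ x)
    (hclaw : ∀ z a b d, IsInducedClaw G z a b d → H a ∨ H b ∨ H d)
    (hZ : ∀ a₁ a₂ a₃ b₁, IsInducedZ1 G a₁ a₂ a₃ b₁ → ¬ H a₂ → ¬ H b₁ →
      ∃ y, y ≠ a₁ ∧ G.Adj a₂ y ∧ G.Adj b₁ y)
    (hx0 : G.Adj x (c 0)) (h1 : ¬ H (c 1)) (h1' : ¬ H (c (-1)))
    (hadj : G.Adj (c 1) (c (-1))) : False := by
  have hle := le_joinOn G H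
  have hc := hM.isCyclicOrder
  have hcm : c m = c 0 := by simpa using hc.periodic 0
  have hcm1 : c (m - 1) = c (-1) := by rw [← hc.periodic (-1), neg_add_eq_sub]
  have hxS : ∀ z ∈ ({x} : Finset V), ∀ i, c i ≠ z := by simpa using hx
  obtain ⟨j, hj3, hjm, hxj, h1j, h1j', hj, hj'⟩ :=
    hM.exists_heavy_add_one hx hclaw hZ hx0 h1 hadj
  obtain ⟨k, hk2, hkm, hxk, h1k, h1k', hk, hk'⟩ :=
    hM.exists_heavy_sub_one hx hclaw hZ hx0 h1' hadj
  rcases lt_trichotomy k j with hkj | rfl | hjk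
  · exact hM.false_of_three_arcs hx
      (hM.joined.pathOn_arc (a := k) (b := j) (by omega) (by omega))
      (hM.joined.pathOn_arc (a := 1) (b := k - 1) (by omega) (by omega))
      (hM.joined.pathOn_arc (a := j + 1) (b := m) (by omega) (by omega))
      (hle hxk) (hle h1j.symm) (.inr ⟨hc.ne (by omega) (by omega), hk, hj⟩)
      (hcm ▸ hle hx0.symm) (by omega) (by omega) (by omega) 1 (by omega)
  · exact hk' hj
  · obtain ⟨l, hlj, hjl, hxl⟩ := hM.exists_common hx hZ (i := j) (j := j - 1) (k := 1) hxj
      (by simp) h1j.symm h1j'.symm (hM.not_adj_add_one hx hx0) hj'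
    have hlk : c l = c k := by
      by_contra hlk
      have haround := hM.not_adj_around_of_sub_one hx hxj hxl hlj.symm hjl.symm
      refine haround (hle (hM.adj_of_not_heavy hx hclaw hxl (hc.adj_sub_one l) (hc.adj l)
        (hM.not_adj_sub_one hx hxl) (hM.not_adj_add_one hx hxl) (hc.sub_one_ne_add_one l)
        ⟨_, rfl⟩ ⟨_, rfl⟩ (fun h => ?_) fun h => ?_))
      · exact hM.not_heavy_sub_one_sub_one hxS (.single x) hxl hxk hlk ⟨h, hk⟩
      · exact hM.not_heavy_add_one_add_one hxS (.single x) hxl hxj hlj ⟨h, hj⟩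
    rw [hlk] at hjl
    have hjk' : G.Adj (c (j - 1)) (c (k + 1)) := hM.adj_of_not_heavy hx hclaw hxk hjl.symm
      (hc.adj k) (hM.not_adj_sub_one hx hxj) (hM.not_adj_add_one hx hxk)
      (hc.ne (by omega) (by omega)) ⟨_, rfl⟩ ⟨_, rfl⟩ hj' hk'
    exact hM.false_of_three_arcs hx
      (hM.joined.pathOn_arc (a := j) (b := k) (by omega) (by omega))
      (hM.joined.pathOn_arc (a := k + 1) (b := m - 1) (by omega) (by omega)).reverse
      (hM.joined.pathOn_arc (a := 0) (b := j - 1) (by omega) (by omega)).reverse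
      (hle hxj) (hcm1 ▸ hle h1k.symm) (hle hjk'.symm) (hle hx0.symm)
      (by omega) (by omega) (by omega) 0 (by omega)

end IsMaximalCycle

/-- In a 3-connected graph, at least three vertices of a cycle are attached to any given component
of its complement. -/
theorem exists_three_attachments [Fintype V] (h3 : ThreeConnected G) (hc : IsCyclicOrder G m c)
    {s : Set V} (hs : ∀ v, v ∈ s ↔ ∀ i, c i ≠ v) (x₀ : s) :
    ∃ i₁ i₂ i₃, c i₁ ≠ c i₂ ∧ c i₁ ≠ c i₃ ∧ c i₂ ≠ c i₃ ∧ ∀ i ∈ ({i₁, i₂, i₃} : Set ℤ),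
      ∃ y : s, (G.induce s).Reachable x₀ y ∧ G.Adj (y : V) (c i) := by
  classical
  let C : Finset V := Finset.univ.filter fun v => ∃ i, c i = v
  let A : Finset V := C.filter fun v =>
    ∃ y : s, (G.induce s).Reachable x₀ y ∧ G.Adj (y : V) v
  have hC3 : 3 ≤ C.card := hc.three_le_card fun i => by simp [C]
  have hA : 2 < A.card := by
    by_contra hA
    obtain ⟨B, hAB, hBC, hB⟩ := Finset.exists_subsuperset_card_eq (Finset.filter_subset _ C)
      (not_lt.1 hA) (by omega : 2 ≤ C.card)
    obtain ⟨z, hzC, hzB⟩ := Finset.exists_mem_notMem_of_card_lt_card (by omega : B.card < C.card)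
    obtain ⟨u, w, -, rfl⟩ := Finset.card_eq_two.1 hB
    have hxC : (x₀ : V) ∉ C := by
      simp only [C, Finset.mem_filter, Finset.mem_univ, true_and, not_exists]
      exact (hs _).1 x₀.2
    have key : ∀ a b : {v | v ≠ u ∧ v ≠ w}, (G.induce {v | v ≠ u ∧ v ≠ w}).Walk a b →
        (∃ h : (a : V) ∈ s, (G.induce s).Reachable x₀ ⟨a, h⟩) →
        ∃ h : (b : V) ∈ s, (G.induce s).Reachable x₀ ⟨b, h⟩ := by
      intro a b p
      induction p with
      | nil => exact id
      | @cons a b d hab p ih =>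
        rintro ⟨ha, hra⟩
        rw [induce_adj] at hab
        apply ih
        by_cases hb : (b : V) ∈ s
        · exact ⟨hb, hra.trans (Adj.reachable (by simpa using hab))⟩
        · have hbA : (b : V) ∈ A := by
            refine Finset.mem_filter.2 ⟨?_, ⟨a, ha⟩, hra, hab⟩
            simpa [hs, C] using hb
          have := hAB hbA
          rw [Finset.mem_insert, Finset.mem_singleton] at this
          exact absurd this (not_or.2 b.2)
    obtain ⟨p⟩ := (h3.2 u w).preconnected
      ⟨x₀, fun h => hxC (h ▸ hBC (by simp)), fun h => hxC (h ▸ hBC (by simp))⟩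
      ⟨z, fun h => hzB (by simp [h]), fun h => hzB (by simp [h])⟩
    obtain ⟨hz, -⟩ := key _ _ p ⟨x₀.2, .rfl⟩
    obtain ⟨i, hi⟩ := (Finset.mem_filter.1 hzC).2
    exact (hs _).1 hz i hi
  obtain ⟨a, ha, b, hb, d, hd, hab, had, hbd⟩ := Finset.two_lt_card.1 hA
  simp only [A, C, Finset.mem_filter, Finset.mem_univ, true_and] at ha hb hd
  obtain ⟨⟨i₁, rfl⟩, ha⟩ := ha
  obtain ⟨⟨i₂, rfl⟩, hb⟩ := hb
  obtain ⟨⟨i₃, rfl⟩, hd⟩ := hd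
  refine ⟨i₁, i₂, i₃, hab, had, hbd, ?_⟩
  simp only [Set.mem_insert_iff, Set.mem_singleton_iff, forall_eq_or_imp, forall_eq]
  exact ⟨ha, hb, hd⟩

theorem IsMaximalCycle.exists_eq [Fintype V] (h3 : ThreeConnected G)
    (hM : IsMaximalCycle G H m c)
    (hclaw : ∀ z a b d, IsInducedClaw G z a b d → H a ∨ H b ∨ H d)
    (hZ : ∀ a₁ a₂ a₃ b₁, IsInducedZ1 G a₁ a₂ a₃ b₁ → ¬ H a₂ → ¬ H b₁ →
      ∃ y, y ≠ a₁ ∧ G.Adj a₂ y ∧ G.Adj b₁ y) (x : V) : ∃ i, c i = x := by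
  by_contra! hx
  have hc := hM.isCyclicOrder
  obtain ⟨i₁, i₂, i₃, h12, h13, h23, hatt⟩ := exists_three_attachments
    (s := {v | ∀ i, c i ≠ v}) h3 hc (fun _ => .rfl) ⟨x, hx⟩
  have hpair : ∀ i ∈ ({i₁, i₂, i₃} : Set ℤ), ∀ j ∈ ({i₁, i₂, i₃} : Set ℤ), c i ≠ c j →
      ¬ (H (c (i + 1)) ∧ H (c (j + 1))) ∧ ¬ (H (c (i - 1)) ∧ H (c (j - 1))) := by
    intro i hi j hj hij
    obtain ⟨y, hxy, hyi⟩ := hatt i hi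
    obtain ⟨z, hxz, hzj⟩ := hatt j hj
    obtain ⟨S, hp, hS⟩ := PathOn.of_reachable_induce (hxy.symm.trans hxz)
    exact ⟨hM.not_heavy_add_one_add_one hS hp hyi hzj hij,
      hM.not_heavy_sub_one_sub_one hS hp hyi hzj hij⟩
  have h12' := hpair i₁ (by simp) i₂ (by simp) h12
  have h13' := hpair i₁ (by simp) i₃ (by simp) h13
  have h23' := hpair i₂ (by simp) i₃ (by simp) h23
  obtain ⟨i, hi, h1, h1'⟩ : ∃ i ∈ ({i₁, i₂, i₃} : Set ℤ), ¬ H (c (i + 1)) ∧ ¬ H (c (i - 1)) := by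
    simp only [Set.mem_insert_iff, Set.mem_singleton_iff, exists_eq_or_imp, exists_eq_left]
    tauto
  obtain ⟨⟨y, hy⟩, -, hyi⟩ := hatt i hi
  have hadj := hM.adj_of_not_heavy hy hclaw hyi (hc.adj i) (hc.adj_sub_one i)
    (hM.not_adj_add_one hy hyi) (hM.not_adj_sub_one hy hyi) (hc.sub_one_ne_add_one i).symm
    ⟨_, rfl⟩ ⟨_, rfl⟩ h1 h1'
  rw [add_comm] at h1 hadj
  rw [sub_eq_neg_add] at h1' hadj
  exact (hM.shift i).false_of_not_heavy (fun j => hy _) hclaw hZ (by simpa using hyi) h1 h1' hadj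

end MaximalCycle

theorem ThreeConnected.exists_adj_ne {V : Type*} [Fintype V] {G : SimpleGraph V}
    (h3 : ThreeConnected G) (p q : V) : ∃ w, w ≠ q ∧ G.Adj p w := by
  classical
  have hcard := h3.1
  have hex : ∀ a b : V, ∃ z, z ≠ a ∧ z ≠ b := fun a b => by
    obtain ⟨z, -, hz⟩ := Finset.exists_mem_notMem_of_card_lt_card (s := {a, b})
      (t := Finset.univ) (by
        rw [Finset.card_univ]
        exact Finset.card_le_two.trans_lt (by omega))
    exact ⟨z, by simpa using hz⟩
  obtain ⟨t, htp, htq⟩ : ∃ t, t ≠ p ∧ (q = p ∨ q = t) := by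
    by_cases hpq : q = p
    · obtain ⟨t, ht, -⟩ := hex p p
      exact ⟨t, ht, .inl hpq⟩
    · exact ⟨q, hpq, .inr rfl⟩
  obtain ⟨z, hzp, hzt⟩ := hex p t
  have : Nontrivial {w | w ≠ t ∧ w ≠ t} :=
    ⟨⟨p, htp.symm, htp.symm⟩, ⟨z, hzt, hzt⟩, by simpa using hzp.symm⟩
  obtain ⟨w, hw⟩ := (h3.2 t t).preconnected.exists_adj_of_nontrivial ⟨p, htp.symm, htp.symm⟩
  rw [induce_adj] at hw
  refine ⟨w, ?_, hw⟩
  rcases htq with rfl | rfl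
  exacts [hw.ne.symm, w.2.1]

/-- A 3-connected graph has a cycle through all heavy vertices. -/
theorem ThreeConnected.exists_cycleOn_heavy {V : Type*} [Fintype V] [DecidableEq V]
    {G : SimpleGraph V} [DecidableRel G.Adj] (h3 : ThreeConnected G) :
    ∃ S, (∀ v, Heavy G v → v ∈ S) ∧ CycleOn G S := by
  classical
  suffices ∃ S, (∀ v, Heavy G v → v ∈ S) ∧ CycleOn (joinOn G (Heavy G)) S by
    obtain ⟨S, hS, hS'⟩ := this
    obtain ⟨T, hST, hT⟩ := hS'.exists_of_joinOn
    exact ⟨T, fun v hv => hST (hS v hv), hT⟩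
  have hle := le_joinOn G (Heavy G)
  let S : Finset V := Finset.univ.filter (Heavy G)
  have hS : ∀ v, v ∈ S ↔ Heavy G v := by simp [S]
  have hclique : ∀ u ∈ S, ∀ v ∈ S, u ≠ v → (joinOn G (Heavy G)).Adj u v :=
    fun u hu v hv huv => .inr ⟨huv, (hS u).1 hu, (hS v).1 hv⟩
  rcases le_or_gt 3 S.card with hcard | hcard
  · obtain ⟨a, b, hab⟩ := PathOn.of_isClique (G := joinOn G (Heavy G)) (S := S)
      (fun u hu v hv => hclique u hu v hv) (Finset.card_pos.1 (by omega))
    refine ⟨S, fun v => (hS v).2, hcard, a, b, hab, hclique b hab.right_mem a hab.left_mem ?_⟩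
    rintro rfl
    rw [hab.eq_singleton, Finset.card_singleton] at hcard
    omega
  · obtain ⟨p, q, hpq, hSpq⟩ : ∃ p q, (joinOn G (Heavy G)).Adj p q ∧ S ⊆ {p, q} := by
      rcases (by omega : S.card = 0 ∨ S.card = 1 ∨ S.card = 2) with h | h | h
      · obtain ⟨p⟩ : Nonempty V := Fintype.card_pos_iff.1 (by have := h3.1; omega)
        obtain ⟨q, -, hq⟩ := h3.exists_adj_ne p p
        exact ⟨p, q, hle hq, by simp [Finset.card_eq_zero.1 h]⟩
      · obtain ⟨p, hp⟩ := Finset.card_eq_one.1 h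
        obtain ⟨q, -, hq⟩ := h3.exists_adj_ne p p
        exact ⟨p, q, hle hq, by simp [hp]⟩
      · obtain ⟨p, q, hne, hpq⟩ := Finset.card_eq_two.1 h
        exact ⟨p, q, hclique p (by simp [hpq]) q (by simp [hpq]) hne, hpq.subset⟩
    obtain ⟨w, hwq, hpw⟩ := h3.exists_adj_ne p q
    obtain ⟨T, hT, hT'⟩ := PathOn.of_reachable_induce ((h3.2 p p).preconnected
      ⟨w, hpw.ne.symm, hpw.ne.symm⟩ ⟨q, hpq.ne.symm, hpq.ne.symm⟩)
    have hp : p ∉ T := fun h => (hT' p h).1 rfl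
    have hwqT : ({w, q} : Finset V) ⊆ T := by
      simp [Finset.insert_subset_iff, hT.left_mem, hT.right_mem]
    refine ⟨insert p T, fun v hv => ?_, ?_, p, q, .cons (hle hpw) (hT.mono hle) hp, hpq.symm⟩
    · have := hSpq ((hS v).2 hv)
      rw [Finset.mem_insert, Finset.mem_singleton] at this
      rcases this with rfl | rfl
      · exact Finset.mem_insert_self _ _
      · exact Finset.mem_insert_of_mem hT.right_mem
    · have := Finset.card_le_card hwqT
      rw [Finset.card_pair hwq] at this
      rw [Finset.card_insert_of_notMem hp]
      omega

theorem CycleOn.isHamiltonian {V : Type*} [Fintype V] [DecidableEq V] {G : SimpleGraph V}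
    {S : Finset V} (h : CycleOn G S) (hS : ∀ v, v ∈ S) : G.IsHamiltonian := by
  intro _
  obtain ⟨h3, a, b, hab, hba⟩ := h
  obtain ⟨p, hp, hpS⟩ := hab.exists_walk
  refine ⟨b, .cons hba p,
    Walk.isHamiltonianCycle_iff_isCycle_and_support_count_tail_eq_one.2 ⟨?_, ?_⟩⟩
  · refine (Walk.cons_isCycle_iff p hba).2 ⟨hp, fun he => ?_⟩
    have h1 := hp.length_eq_one_of_mem_edges (Sym2.eq_swap ▸ he)
    have h2 : S ⊆ p.support.toFinset := fun v hv => by simpa using (hpS v).2 hv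
    have := (Finset.card_le_card h2).trans p.support.toFinset_card_le
    rw [Walk.length_support] at this
    omega
  · exact hp.isHamiltonian_of_mem fun w => (hpS w).2 (hS w)

theorem isHamiltonian_of_heavy_conditions {V : Type*} [Fintype V] [DecidableEq V]
    {G : SimpleGraph V} [DecidableRel G.Adj] (h3 : ThreeConnected G) (hheavy : OneHeavy G)
    (hZ : ∀ a₁ a₂ a₃ b₁, IsInducedZ1 G a₁ a₂ a₃ b₁ → ¬ Heavy G a₂ → ¬ Heavy G b₁ →
      ∃ y, y ≠ a₁ ∧ G.Adj a₂ y ∧ G.Adj b₁ y) : G.IsHamiltonian := by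
  classical
  obtain ⟨S₀, hS₀⟩ := h3.exists_cycleOn_heavy
  obtain ⟨S, hS, hmax⟩ := Finset.exists_max_image
    (Finset.univ.filter fun S : Finset V => (∀ v, Heavy G v → v ∈ S) ∧ CycleOn G S)
    Finset.card ⟨S₀, by simpa using hS₀⟩
  simp only [Finset.mem_filter, Finset.mem_univ, true_and] at hS hmax
  obtain ⟨m, c, hc, hSc⟩ := hS.2.exists_isCyclicOrder
  have hM : IsMaximalCycle G (Heavy G) m c := by
    refine ⟨hc, fun v hv => (hSc v).1 (hS.1 v hv), fun a b T hab hba hT x hx => ?_⟩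
    obtain ⟨U, hTU, hU⟩ := CycleOn.exists_of_joinOn
      (⟨hc.three_le_card hT, a, b, hab, hba⟩ : CycleOn (joinOn G (Heavy G)) T)
    have hSU : S ⊆ U := fun v hv => by
      obtain ⟨i, rfl⟩ := (hSc v).1 hv
      exact hTU (hT i)
    have heq := Finset.eq_of_subset_of_card_le hSU
      (hmax U ⟨fun v hv => hSU (hS.1 v hv), hU⟩)
    exact (hSc x).1 (heq ▸ hTU hx)
  exact hS.2.isHamiltonian fun v => (hSc v).2 (hM.exists_eq h3 hheavy hZ v)

/-- **Theorem 11 of the paper.** Let `G` be a 3-connected 1-heavy graph. If every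
pair of vertices at distance 2 within an induced copy `H` of `Z₁` (namely the
pairs `{a₂,b₁}` and `{a₃,b₁}`) satisfies Fan's or Shi's condition in `G`, then
`G` is Hamiltonian. -/
theorem ning_zhang_chen_th11 {V : Type*} [Fintype V] [DecidableEq V]
    (G : SimpleGraph V) [DecidableRel G.Adj]
    (h3 : ThreeConnected G)
    (hheavy : OneHeavy G)
    (h : ∀ a1 a2 a3 b1 : V, IsInducedZ1 G a1 a2 a3 b1 →
      FanOrShi G a2 b1 ∧ FanOrShi G a3 b1) :
    G.IsHamiltonian := by
  exact isHamiltonian_of_heavy_conditions h3 hheavy fun a₁ a₂ a₃ b₁ hZ h₂ hb => by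
    obtain h' | h' | h' := (h a₁ a₂ a₃ b₁ hZ).1
    · exact absurd h' h₂
    · exact absurd h' hb
    · obtain ⟨y, hy, hne⟩ := Finset.exists_mem_ne h' a₁
      simp only [Finset.mem_inter, mem_neighborFinset] at hy
      exact ⟨y, hne, hy⟩
end

section
/- Let G be a 2-connected K_{1,4}-o-heavy graph on n vertices. Then every longest cycle of G contains all vertices of degree at least n/2. -/
open SimpleGraph

/-- `c, a, b, d, e` form an induced copy of `K_{1,4}` in `G` with center `c`. -/
def IsInducedK14 {V : Type*} (G : SimpleGraph V) (c a b d e : V) : Prop :=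
  a ≠ b ∧ a ≠ d ∧ a ≠ e ∧ b ≠ d ∧ b ≠ e ∧ d ≠ e ∧
  G.Adj c a ∧ G.Adj c b ∧ G.Adj c d ∧ G.Adj c e ∧
  ¬G.Adj a b ∧ ¬G.Adj a d ∧ ¬G.Adj a e ∧ ¬G.Adj b d ∧ ¬G.Adj b e ∧ ¬G.Adj d e

/-- `G` is `K_{1,4}`-o-heavy: every induced `K_{1,4}` contains two nonadjacent
vertices whose degree sum is at least `n`. -/
def K14OHeavy {V : Type*} [Fintype V] (G : SimpleGraph V) [DecidableRel G.Adj] : Prop :=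
  ∀ c a b d e : V, IsInducedK14 G c a b d e →
    ∃ u v, u ∈ ({c, a, b, d, e} : Set V) ∧ v ∈ ({c, a, b, d, e} : Set V) ∧
      u ≠ v ∧ ¬G.Adj u v ∧ Fintype.card V ≤ G.degree u + G.degree v

/-- The vertices `u, l, v` are consecutively adjacent, that is, `l` lists the interior vertices of a
walk from `u` to `v`. -/
def Via {V : Type*} (G : SimpleGraph V) (u : V) (l : List V) (v : V) : Prop :=
  (u :: (l ++ [v])).IsChain G.Adj

/-- The list `a :: t` enumerates the vertices of a cycle. -/
structure IsCyc {V : Type*} (G : SimpleGraph V) (a : V) (t : List V) : Prop where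
  via : Via G a t a
  nodup : (a :: t).Nodup
  two_le : 2 ≤ t.length

section Via

variable {V : Type*} {G G₁ : SimpleGraph V} {u v w : V} {l l₁ l₂ : List V}

@[simp] lemma via_nil : Via G u [] v ↔ G.Adj u v := by simp [Via]

@[simp] lemma via_cons : Via G u (w :: l) v ↔ G.Adj u w ∧ Via G w l v := by simp [Via]

@[simp] lemma via_append : Via G u (l₁ ++ w :: l₂) v ↔ Via G u l₁ w ∧ Via G w l₂ v := by
  have := List.isChain_split (R := G.Adj) (c := w) (l₁ := u :: l₁) (l₂ := l₂ ++ [v])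
  simpa [Via] using this

lemma via_reverse : Via G u l.reverse v ↔ Via G v l u := by
  have := List.isChain_reverse (R := G.Adj) (l := v :: (l ++ [u]))
  simpa [Via, G.adj_comm] using this

lemma Via.mono (h : G ≤ G₁) (hv : Via G u l v) : Via G₁ u l v :=
  List.IsChain.imp (fun _ _ hab => h hab) hv

lemma Via.of_pairwise (h : (u :: (l ++ [v])).Pairwise G.Adj) : Via G u l v := h.isChain

lemma Via.restrict (hv : Via G₁ w l v)
    (hG : ∀ r s, G₁.Adj r s → G.Adj r s ∨ r = u ∨ s = u)
    (hu : u ∉ w :: (l ++ [v])) : Via G w l v := by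
  refine List.IsChain.imp_of_mem_imp (fun r s hr hs hrs => ?_) hv
  rcases hG r s hrs with h | rfl | rfl
  · exact h
  · exact absurd hr hu
  · exact absurd hs hu

lemma Via.or_exists (hv : Via G₁ u l v) :
    Via G u l v ∨ ∃ l₁ p q l₂, u :: (l ++ [v]) = l₁ ++ p :: q :: l₂ ∧ G₁.Adj p q ∧ ¬G.Adj p q := by
  induction l generalizing u with
  | nil =>
    by_cases h : G.Adj u v
    · exact Or.inl (by simpa using h)
    · exact Or.inr ⟨[], u, v, [], by simp, by simpa using hv, h⟩
  | cons w l ih =>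
    rw [via_cons] at hv
    by_cases h : G.Adj u w
    · rcases ih hv.2 with h' | ⟨l₁, p, q, l₂, he, h1, h2⟩
      · exact Or.inl (by simp [h, h'])
      · exact Or.inr ⟨u :: l₁, p, q, l₂, by simpa using he, h1, h2⟩
    · exact Or.inr ⟨[], u, w, l ++ [v], by simp, hv.1, h⟩

lemma IsCyc.rotate {a b : V} {A B : List V} (h : IsCyc G a (A ++ b :: B)) :
    IsCyc G b (B ++ a :: A) := by
  obtain ⟨h1, h2, h3⟩ := h
  rw [via_append] at h1
  refine ⟨via_append.2 ⟨h1.2, h1.1⟩, ?_, ?_⟩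
  · have : (b :: (B ++ a :: A)).Perm (a :: (A ++ b :: B)) := by
      simpa using (List.perm_append_comm (l₁ := b :: B) (l₂ := a :: A))
    exact this.nodup_iff.2 h2
  · simp at h3 ⊢; omega

lemma IsCyc.exists_bad_edge {c : V} {t : List V} (h : IsCyc G₁ c t) :
    IsCyc G c t ∨ ∃ p q t', Via G₁ q t' p ∧ (q :: (t' ++ [p])).Nodup ∧ t'.length + 1 = t.length ∧
      G₁.Adj p q ∧ ¬G.Adj p q := by
  rcases h.via.or_exists (G := G) with h' | ⟨l₁, p, q, l₂, he, h1, h2⟩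
  · exact Or.inl ⟨h', h.nodup, h.two_le⟩
  right
  have hn := h.nodup
  have hv := h.via
  cases l₁ with
  | nil =>
    simp only [List.nil_append, List.cons.injEq] at he
    obtain ⟨rfl, he⟩ := he
    cases t with
    | nil => simpa using h.two_le
    | cons d t =>
      simp only [List.cons_append, List.cons.injEq] at he
      obtain ⟨rfl, he⟩ := he
      refine ⟨c, d, t, (via_cons.1 hv).2, ?_, by simp, h1, h2⟩
      have : (d :: (t ++ [c])).Perm (c :: d :: t) := by
        simpa using (List.perm_append_comm (l₁ := d :: t) (l₂ := [c]))
      exact this.nodup_iff.2 hn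
  | cons c' l₁ =>
    simp only [List.cons_append, List.cons.injEq] at he
    obtain ⟨rfl, he⟩ := he
    rcases List.eq_nil_or_concat l₂ with rfl | ⟨l₂, e, rfl⟩
    · have he' : t ++ [c] = (l₁ ++ [p]) ++ [q] := by simpa using he
      obtain ⟨rfl, hq⟩ := List.append_inj' he' rfl
      simp only [List.cons.injEq, and_true] at hq
      subst hq
      exact ⟨p, c, l₁, (via_append.1 hv).1, hn, by simp, h1, h2⟩
    · have he' : t ++ [c] = (l₁ ++ p :: q :: l₂) ++ [e] := by simpa using he
      obtain ⟨rfl, hq⟩ := List.append_inj' he' rfl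
      simp only [List.cons.injEq, and_true] at hq
      subst hq
      rw [via_append, via_cons] at hv
      refine ⟨p, q, l₂ ++ c :: l₁, via_append.2 ⟨hv.2.2, hv.1⟩, ?_, by simp; omega, h1, h2⟩
      have : (q :: (l₂ ++ c :: l₁ ++ [p])).Perm (c :: (l₁ ++ p :: q :: l₂)) := by
        simpa using (List.perm_append_comm (l₁ := q :: l₂) (l₂ := c :: (l₁ ++ [p])))
      exact this.nodup_iff.2 hn

lemma exists_support_cons_eq (h : G.Adj u w) (p : G.Walk w v) :
    ∃ l, (SimpleGraph.Walk.cons h p).support = u :: (l ++ [v]) := by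
  induction p generalizing u with
  | nil => exact ⟨[], by simp⟩
  | @cons a b c h' p ih =>
    obtain ⟨l, hl⟩ := ih h'
    exact ⟨a :: l, by rw [SimpleGraph.Walk.support_cons, hl]; simp⟩

lemma exists_isCyc_of_isCycle (C : G.Walk v v) (hC : C.IsCycle) :
    ∃ a t, IsCyc G a t ∧ t.length + 1 = C.length ∧ ∀ y, y ∈ a :: t ↔ y ∈ C.support := by
  cases C with
  | nil => exact absurd hC (by simp)
  | @cons _ w _ h p =>
    obtain ⟨l, hl⟩ := exists_support_cons_eq h p
    have hch := (SimpleGraph.Walk.cons h p).isChain_adj_support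
    have hn := hC.support_nodup
    have h3 := hC.three_le_length
    have hlen := congrArg List.length hl
    rw [hl] at hch hn
    simp only [List.tail_cons] at hn
    rw [SimpleGraph.Walk.length_support] at hlen
    simp only [List.length_cons, List.length_append, List.length_nil] at hlen
    refine ⟨v, l, ⟨hch, List.perm_append_singleton v l |>.nodup_iff.1 hn, by omega⟩, by omega, ?_⟩
    intro y
    rw [hl]
    simp only [List.mem_cons, List.mem_append, List.not_mem_nil]
    tauto

lemma Via.exists_walk (h : Via G u l v) : ∃ p : G.Walk u v, p.support = u :: (l ++ [v]) := by
  induction l generalizing u with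
  | nil => exact ⟨SimpleGraph.Walk.cons (via_nil.1 h) SimpleGraph.Walk.nil, by simp⟩
  | cons w l ih =>
    obtain ⟨p, hp⟩ := ih (via_cons.1 h).2
    exact ⟨SimpleGraph.Walk.cons (via_cons.1 h).1 p, by simp [hp]⟩

lemma IsCyc.exists_isCycle {a : V} {t : List V} (h : IsCyc G a t) :
    ∃ C : G.Walk a a, C.IsCycle ∧ C.length = t.length + 1 := by
  obtain ⟨h1, h2, h3⟩ := h
  cases t with
  | nil => simp at h3
  | cons b t =>
    rw [via_cons] at h1
    obtain ⟨p, hp⟩ := h1.2.exists_walk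
    have hl : p.length = t.length + 1 := by
      have := congrArg List.length hp
      simpa using this
    refine ⟨SimpleGraph.Walk.cons h1.1 p, ?_, by simp [hl]⟩
    rw [SimpleGraph.Walk.isCycle_iff_isPath_tail_and_le_length]
    refine ⟨?_, by simp at h3 ⊢; omega⟩
    rw [SimpleGraph.Walk.tail_cons]
    have : (b :: (t ++ [a])).Perm (a :: b :: t) := by
      simpa using (List.perm_append_comm (l₁ := b :: t) (l₂ := [a]))
    simpa [SimpleGraph.Walk.isPath_def, hp] using this.nodup_iff.2 h2

end Via

section Closure

lemma List.countP_dropLast_add_countP_tail_lt {α : Type*} (P Q : α → Prop) [DecidablePred P]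
    [DecidablePred Q] (L : List α) (hL : L ≠ [])
    (h : ∀ l₁ u v l₂, L = l₁ ++ u :: v :: l₂ → ¬(P u ∧ Q v)) :
    L.dropLast.countP P + L.tail.countP Q < L.length := by
  induction L with
  | nil => exact absurd rfl hL
  | cons c L ih =>
    cases L with
    | nil => simp
    | cons d L =>
      have h1 := ih (by simp) (fun l₁ u v l₂ he => h (c :: l₁) u v l₂ (by simp [he]))
      have h2 := h [] c d L rfl
      simp only [List.dropLast_cons_cons, List.tail_cons, List.countP_cons, List.length_cons] at h1 ⊢
      by_cases hP : P c <;> by_cases hQ : Q d <;> simp_all <;> omega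

open Classical in
lemma card_filter_adj_eq_countP_add {V : Type*} [Fintype V] (G : SimpleGraph V) (x : V) (L : List V)
    (hL : L.Nodup) :
    (Finset.univ.filter (G.Adj x)).card =
      L.countP (G.Adj x) + (Finset.univ.filter fun y => G.Adj x y ∧ y ∉ L).card := by
  have h1 : L.countP (G.Adj x) = (Finset.univ.filter fun y => G.Adj x y ∧ y ∈ L).card := by
    rw [List.countP_eq_length_filter, ← List.toFinset_card_of_nodup (hL.filter _)]
    congr 1
    ext y
    simp [and_comm]
  rw [h1, ← Finset.card_filter_add_card_filter_not (s := Finset.univ.filter (G.Adj x)) (· ∈ L),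
    Finset.filter_filter, Finset.filter_filter]

variable {V : Type*} [Fintype V]

open Classical in
lemma exists_isCyc_of_via {G : SimpleGraph V} {p q : V} {t : List V} (hv : Via G q t p)
    (hn : (q :: (t ++ [p])).Nodup) (ht : 1 ≤ t.length)
    (hd : Fintype.card V ≤
      (Finset.univ.filter (G.Adj p)).card + (Finset.univ.filter (G.Adj q)).card) :
    ∃ c' t', IsCyc G c' t' ∧ t.length + 1 ≤ t'.length := by
  by_cases hz : ∃ z, G.Adj p z ∧ G.Adj q z ∧ z ∉ q :: (t ++ [p])
  · obtain ⟨z, hpz, hqz, hzL⟩ := hz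
    refine ⟨z, q :: (t ++ [p]), ⟨?_, List.nodup_cons.2 ⟨hzL, hn⟩, by simp⟩, by simp⟩
    simp [hqz.symm, hv, hpz]
  have hcyc : G.Adj p q → ∃ c' t', IsCyc G c' t' ∧ t.length + 1 ≤ t'.length := fun hpq =>
    ⟨q, t ++ [p], ⟨by simp [hv, hpq], hn, by simp; omega⟩, by simp⟩
  by_cases hcross : ∃ l₁ u v l₂, q :: (t ++ [p]) = l₁ ++ u :: v :: l₂ ∧ G.Adj p u ∧ G.Adj q v
  · obtain ⟨l₁, u, v, l₂, he, hpu, hqv⟩ := hcross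
    cases l₁ with
    | nil =>
      simp only [List.nil_append, List.cons.injEq] at he
      obtain ⟨rfl, -⟩ := he
      exact hcyc hpu
    | cons q' l₁ =>
      simp only [List.cons_append, List.cons.injEq] at he
      obtain ⟨rfl, he⟩ := he
      rcases List.eq_nil_or_concat l₂ with rfl | ⟨l₂, e, rfl⟩
      · have he' : t ++ [p] = (l₁ ++ [u]) ++ [v] := by simpa using he
        obtain ⟨rfl, hq⟩ := List.append_inj' he' rfl
        simp only [List.cons.injEq, and_true] at hq
        subst hq
        exact hcyc hqv.symm
      · have he' : t ++ [p] = (l₁ ++ u :: v :: l₂) ++ [e] := by simpa using he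
        obtain ⟨rfl, hq⟩ := List.append_inj' he' rfl
        simp only [List.cons.injEq, and_true] at hq
        subst hq
        rw [via_append, via_cons] at hv
        refine ⟨q, l₁ ++ u :: p :: (l₂.reverse ++ [v]), ⟨?_, ?_, by simp; omega⟩, by simp⟩
        · simp [hv.1, hpu.symm, via_reverse, hv.2.2, hqv.symm]
        · have hp : (p :: (l₂.reverse ++ [v])).Perm (v :: l₂ ++ [p]) := by
            simpa using (List.reverse_perm (v :: l₂ ++ [p]))
          have : (q :: (l₁ ++ u :: p :: (l₂.reverse ++ [v]))).Perm
              (q :: (l₁ ++ u :: v :: l₂ ++ [p])) := by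
            simpa using ((hp.cons u).append_left l₁)
          exact this.nodup_iff.2 hn
  exfalso
  set L := q :: (t ++ [p]) with hLdef
  have h1 := List.countP_dropLast_add_countP_tail_lt (G.Adj p) (G.Adj q) L (by simp [L])
    (fun l₁ u v l₂ he h => hcross ⟨l₁, u, v, l₂, he, h.1, h.2⟩)
  have h2 : L.dropLast.countP (G.Adj p) = L.countP (G.Adj p) := by
    have : L = (q :: t) ++ [p] := by simp [L]
    rw [this, List.dropLast_concat, List.countP_append]
    simp
  have h3 : L.tail.countP (G.Adj q) = L.countP (G.Adj q) := by
    simp [L, List.countP_cons]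
  have h4 := card_filter_adj_eq_countP_add G p L hn
  have h5 := card_filter_adj_eq_countP_add G q L hn
  have h6 : (Finset.univ.filter fun y => G.Adj p y ∧ y ∉ L).card +
      (Finset.univ.filter fun y => G.Adj q y ∧ y ∉ L).card + L.length ≤ Fintype.card V := by
    rw [← List.toFinset_card_of_nodup hn, ← Finset.card_union_of_disjoint,
      ← Finset.card_union_of_disjoint]
    · exact Finset.card_le_univ _
    · rw [Finset.disjoint_left]
      intro y hy
      simp only [Finset.mem_union, Finset.mem_filter] at hy
      rw [List.mem_toFinset]
      tauto
    · rw [Finset.disjoint_left]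
      intro y hy hy'
      simp only [Finset.mem_filter] at hy hy'
      exact hz ⟨y, hy.2.1, hy'.2.1, hy.2.2⟩
  omega

open Classical in
/-- Joining one pair of vertices of degree sum at least `n` does not increase the circumference. -/
lemma IsCyc.exists_of_sup_edge {G : SimpleGraph V} {a b : V}
    (hd : Fintype.card V ≤
      (Finset.univ.filter (G.Adj a)).card + (Finset.univ.filter (G.Adj b)).card)
    {c : V} {t : List V} (h : IsCyc (G ⊔ SimpleGraph.edge a b) c t) :
    ∃ c' t', IsCyc G c' t' ∧ t.length ≤ t'.length := by
  rcases h.exists_bad_edge (G := G) with h' | ⟨p, q, t', hv, hn, hlen, hpq, hpq'⟩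
  · exact ⟨c, t, h', le_rfl⟩
  have h2 := h.two_le
  have hab : (p = a ∧ q = b) ∨ (p = b ∧ q = a) := by
    simp only [SimpleGraph.sup_adj, hpq', SimpleGraph.edge_adj, false_or] at hpq
    tauto
  have hbad : ∀ r s, (G ⊔ SimpleGraph.edge a b).Adj r s →
      G.Adj r s ∨ (r = p ∧ s = q) ∨ (r = q ∧ s = p) := by
    intro r s hrs
    simp only [SimpleGraph.sup_adj, SimpleGraph.edge_adj] at hrs
    rcases hab with ⟨rfl, rfl⟩ | ⟨rfl, rfl⟩ <;> tauto
  have hv' : Via G q t' p := by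
    cases t' with
    | nil => simp at hlen; omega
    | cons d t' =>
      rw [via_cons] at hv ⊢
      rw [List.cons_append, List.nodup_cons] at hn
      refine ⟨?_, hv.2.restrict (u := q) (fun r s hrs => ?_) hn.1⟩
      · rcases hbad _ _ hv.1 with h | ⟨-, rfl⟩ | ⟨-, rfl⟩
        · exact h
        · simp at hn
        · simp at hn
      · rcases hbad _ _ hrs with h | h | h <;> tauto
  have hd' : Fintype.card V ≤
      (Finset.univ.filter (G.Adj p)).card + (Finset.univ.filter (G.Adj q)).card := by
    rcases hab with ⟨rfl, rfl⟩ | ⟨rfl, rfl⟩ <;> omega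
  obtain ⟨c', t'', h1, h3⟩ := exists_isCyc_of_via hv' hn (by omega) hd'
  exact ⟨c', t'', h1, by omega⟩

open Classical in
/-- Joining pairs of vertices of degree sum at least `n` does not increase the circumference. -/
lemma IsCyc.exists_of_le_degree_add {G G₁ : SimpleGraph V} (hle : G ≤ G₁)
    (hd : ∀ a b, G₁.Adj a b → G.Adj a b ∨ Fintype.card V ≤
      (Finset.univ.filter (G.Adj a)).card + (Finset.univ.filter (G.Adj b)).card)
    {c : V} {t : List V} (h : IsCyc G₁ c t) :
    ∃ c' t', IsCyc G c' t' ∧ t.length ≤ t'.length := by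
  induction hk : (G₁.edgeSet \ G.edgeSet).ncard using Nat.strong_induction_on
    generalizing G c t with
  | _ k ih =>
    by_cases hEq : G₁ ≤ G
    · obtain rfl := le_antisymm hle hEq
      exact ⟨c, t, h, le_rfl⟩
    obtain ⟨a, b, hab, hab'⟩ : ∃ a b, G₁.Adj a b ∧ ¬G.Adj a b := by
      by_contra! hcon
      exact hEq fun a b hab => hcon a b hab
    have hdab := (hd a b hab).resolve_left hab'
    have hle' : G ⊔ SimpleGraph.edge a b ≤ G₁ := by
      refine sup_le hle ?_
      intro r s hrs
      rw [SimpleGraph.edge_adj] at hrs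
      rcases hrs.1 with ⟨rfl, rfl⟩ | ⟨rfl, rfl⟩
      · exact hab
      · exact hab.symm
    have hmono : ∀ r, (Finset.univ.filter (G.Adj r)).card ≤
        (Finset.univ.filter ((G ⊔ SimpleGraph.edge a b).Adj r)).card := fun r =>
      Finset.card_le_card fun y hy => by
        simp only [Finset.mem_filter, Finset.mem_univ, true_and] at hy ⊢
        exact Or.inl hy
    have hlt : (G₁.edgeSet \ (G ⊔ SimpleGraph.edge a b).edgeSet).ncard < k := by
      rw [← hk]
      refine Set.ncard_lt_ncard ((Set.ssubset_iff_of_subset ?_).2 ⟨s(a, b), ?_, ?_⟩) (Set.toFinite _)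
      · exact Set.sdiff_subset_sdiff_right (SimpleGraph.edgeSet_mono le_sup_left)
      · simp [hab, hab']
      · simp [hab.ne]
    have hd' : ∀ r s, G₁.Adj r s → (G ⊔ SimpleGraph.edge a b).Adj r s ∨ Fintype.card V ≤
        (Finset.univ.filter ((G ⊔ SimpleGraph.edge a b).Adj r)).card +
          (Finset.univ.filter ((G ⊔ SimpleGraph.edge a b).Adj s)).card := by
      intro r s hrs
      rcases hd r s hrs with h' | h'
      · exact Or.inl (Or.inl h')
      · exact Or.inr (h'.trans (add_le_add (hmono r) (hmono s)))
    obtain ⟨c', t', h1, h2⟩ := ih _ hlt hle' (fun r s hrs => by convert hd' r s hrs) h rfl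
    obtain ⟨c'', t'', h3, h4⟩ := h1.exists_of_sup_edge hdab
    exact ⟨c'', t'', h3, h2.trans h4⟩

end Closure

section Lists

variable {α : Type*} {P : α → Prop} [DecidablePred P] {L : List α}

lemma List.countP_take_eq_zero {r : ℕ} (h : ∀ L₁ w L₂, L = L₁ ++ w :: L₂ → P w → r ≤ L₁.length) :
    (L.take r).countP P = 0 := by
  rw [List.countP_eq_zero]
  intro w hw hP
  obtain ⟨s, s', hs⟩ := List.append_of_mem hw
  have h1 := h s w (s' ++ L.drop r) (by
    rw [← List.cons_append, ← List.append_assoc, ← hs, List.take_append_drop]) (by simpa using hP)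
  have h2 := congrArg List.length hs
  simp at h2
  omega

lemma List.add_countP_le_length {r : ℕ} (hr : r ≤ L.length)
    (h : ∀ L₁ w L₂, L = L₁ ++ w :: L₂ → P w → r ≤ L₁.length) : r + L.countP P ≤ L.length := by
  have h1 : L.countP P = (L.take r).countP P + (L.drop r).countP P := by
    rw [← List.countP_append, List.take_append_drop]
  rw [List.countP_take_eq_zero h] at h1
  have h2 := List.countP_le_length (p := P) (l := L.drop r)
  rw [List.length_drop] at h2
  omega

lemma List.two_mul_countP_le (h : ∀ L₁ u v L₂, L = L₁ ++ u :: v :: L₂ → ¬(P u ∧ P v)) :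
    2 * L.countP P ≤ L.length + 1 := by
  have h1 := List.countP_dropLast_add_countP_tail_lt P P L
  cases L with
  | nil => simp
  | cons c L =>
    have h2 := h1 (by simp) h
    rcases List.eq_nil_or_concat (c :: L) with h0 | ⟨M, e, he⟩
    · simp at h0
    · have h3 : (c :: L).countP P ≤ (c :: L).dropLast.countP P + 1 := by
        rw [he, List.concat_eq_append, List.dropLast_concat, List.countP_append]
        have := List.countP_le_length (p := P) (l := [e])
        simpa using this
      have h4 : (c :: L).countP P ≤ (c :: L).tail.countP P + 1 := by
        rw [List.countP_cons, List.tail_cons]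
        split <;> omega
      omega

lemma List.add_two_mul_countP_le {j k : ℕ} (hjk : j + k ≤ L.length + 1)
    (h : ∀ L₁ w L₂, L = L₁ ++ w :: L₂ → P w → j ≤ L₁.length ∧ k ≤ L₂.length)
    (h' : ∀ L₁ u v L₂, L = L₁ ++ u :: v :: L₂ → ¬(P u ∧ P v)) :
    j + k + 2 * L.countP P ≤ L.length + 1 := by
  by_cases h0 : L.countP P = 0
  · omega
  obtain ⟨w, hw, hPw⟩ := List.countP_pos_iff.1 (Nat.pos_of_ne_zero h0)
  obtain ⟨s, s', hs⟩ := List.append_of_mem hw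
  have hlen := h s w s' hs (by simpa using hPw)
  have hlen' := congrArg List.length hs
  simp only [List.length_append, List.length_cons] at hlen'
  have e1 : L.countP P = (L.take j).countP P + (L.drop j).countP P := by
    rw [← List.countP_append, List.take_append_drop]
  rw [List.countP_take_eq_zero fun L₁ w L₂ he hP => (h L₁ w L₂ he hP).1] at e1
  set D := L.drop j with hD
  have hLD : L = L.take j ++ D := (List.take_append_drop j L).symm
  have e2 : D.reverse.countP P =
      (D.reverse.take k).countP P + (D.reverse.drop k).countP P := by
    rw [← List.countP_append, List.take_append_drop]
  rw [List.countP_take_eq_zero (L := D.reverse), List.countP_reverse] at e2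
  · have e3 := List.two_mul_countP_le (P := P) (L := D.reverse.drop k) fun L₁ u v L₂ he => by
      have e4 : D.reverse = D.reverse.take k ++ (L₁ ++ u :: v :: L₂) := by
        rw [← he, List.take_append_drop]
      have e5 := congrArg List.reverse e4
      rw [List.reverse_reverse] at e5
      have e6 := h' (L.take j ++ L₂.reverse) v u (L₁.reverse ++ (D.reverse.take k).reverse) (hLD.trans (by
        conv_lhs => rw [e5]
        simp))
      tauto
    simp only [List.length_drop, List.length_reverse, hD] at e3
    rw [← hD] at e3
    omega
  · intro L₁ w L₂ he hP
    have e5 := congrArg List.reverse he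
    rw [List.reverse_reverse] at e5
    have := (h (L.take j ++ L₂.reverse) w L₁.reverse (hLD.trans (by
      conv_lhs => rw [e5]
      simp)) hP).2
    simpa using this

end Lists

lemma exists_max_nat {P : ℕ → Prop} (h : ∃ k, P k) (N : ℕ) (hN : ∀ k, P k → k ≤ N) :
    ∃ m, P m ∧ ∀ k, P k → k ≤ m :=
  have hb : BddAbove {k | P k} := ⟨N, hN⟩
  ⟨sSup {k | P k}, Nat.sSup_mem (s := {k | P k}) h hb, fun _ hk => le_csSup hb hk⟩

section Connectivity

variable {V : Type*} {G : SimpleGraph V}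

/-- Deleting any vertex `t` leaves the remaining vertices joined by paths. -/
def PathsAvoid (G : SimpleGraph V) : Prop :=
  ∀ t u v, u ≠ t → v ≠ t → u ≠ v → ∃ l, Via G u l v ∧ (u :: (l ++ [v])).Nodup ∧ t ∉ l

lemma pathsAvoid_of_connected (h : ∀ v : V, (G.induce {w | w ≠ v}).Connected) : PathsAvoid G := by
  intro t u v hu hv huv
  obtain ⟨p, hp⟩ := (h t).exists_isPath ⟨u, hu⟩ ⟨v, hv⟩
  cases p with
  | nil => exact absurd rfl huv
  | cons h' p =>
    obtain ⟨l, hl⟩ := exists_support_cons_eq h' p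
    have hch := (SimpleGraph.Walk.cons h' p).isChain_adj_support
    have hn := hp.support_nodup
    rw [hl] at hch hn
    refine ⟨l.map Subtype.val, ?_, ?_, ?_⟩
    · have := (List.isChain_map (R := G.Adj) Subtype.val).2 hch
      simpa [Via] using this
    · have := hn.map Subtype.val_injective
      simpa using this
    · intro ht
      obtain ⟨y, -, hy⟩ := List.mem_map.1 ht
      exact y.2 hy

/-- A shortest path from `M` to `S` avoiding `t`. -/
lemma PathsAvoid.exists_via (hG : PathsAvoid G) {M S : Set V} {t : V} (hM : M.Nonempty)
    (htM : t ∉ M) (hMS : ∀ y ∈ M, y ∉ S) (hS : ∃ s ∈ S, s ≠ t) :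
    ∃ m l w, m ∈ M ∧ w ∈ S ∧ w ≠ t ∧ Via G m l w ∧ l.Nodup ∧ ∀ y ∈ l, y ∉ M ∧ y ∉ S ∧ y ≠ t := by
  classical
  have hex : ∃ k m l w, m ∈ M ∧ w ∈ S ∧ w ≠ t ∧ Via G m l w ∧ l.Nodup ∧ t ∉ l ∧ l.length = k := by
    obtain ⟨m, hm⟩ := hM
    obtain ⟨s, hs, hst⟩ := hS
    obtain ⟨l, h1, h2, h3⟩ := hG t m s (fun h => htM (h ▸ hm)) hst (fun h => hMS m hm (h ▸ hs))
    exact ⟨_, m, l, s, hm, hs, hst, h1, (List.nodup_append.1 (List.nodup_cons.1 h2).2).1, h3, rfl⟩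
  obtain ⟨m, l, w, hm, hw, hwt, hv, hn, ht, hk⟩ := Nat.find_spec hex
  refine ⟨m, l, w, hm, hw, hwt, hv, hn, fun y hy => ?_⟩
  have hyt : y ≠ t := fun h => ht (h ▸ hy)
  obtain ⟨l₁, l₂, rfl⟩ := List.append_of_mem hy
  rw [via_append] at hv
  simp only [List.mem_append, List.mem_cons, not_or] at ht
  have hn₁ := (List.nodup_append.1 hn).1
  have hn₂ := (List.nodup_cons.1 (List.nodup_append.1 hn).2.1).2
  simp only [List.length_append, List.length_cons] at hk
  refine ⟨fun hyM => ?_, fun hyS => ?_, hyt⟩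
  · have := Nat.find_min' hex ⟨y, l₂, w, hyM, hw, hwt, hv.2, hn₂, ht.2.2, rfl⟩
    omega
  · have := Nat.find_min' hex ⟨m, l₁, y, hm, hyS, hyt, hv.1, hn₁, ht.1, rfl⟩
    omega

end Connectivity

section Arcs

variable {V : Type*} {G : SimpleGraph V} {a b x : V} {A B Y₁ Y₂ : List V} {K : ℕ}

lemma IsCyc.exists_eq_append {c : V} {t : List V} (h : IsCyc G c t) (ha : a ∈ c :: t)
    (hb : b ∈ c :: t) (hab : a ≠ b) :
    ∃ A B, IsCyc G a (A ++ b :: B) ∧ (∀ y, y ∈ a :: (A ++ b :: B) ↔ y ∈ c :: t) ∧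
      (A ++ b :: B).length = t.length := by
  obtain ⟨t', h', hmem, hlen⟩ : ∃ t', IsCyc G a t' ∧ (∀ y, y ∈ a :: t' ↔ y ∈ c :: t) ∧
      t'.length = t.length := by
    rcases List.mem_cons.1 ha with rfl | ha
    · exact ⟨t, h, fun _ => Iff.rfl, rfl⟩
    · obtain ⟨A, B, rfl⟩ := List.append_of_mem ha
      refine ⟨_, h.rotate, fun y => ?_, by simp; omega⟩
      simp only [List.mem_cons, List.mem_append]
      tauto
  have hb' : b ∈ t' := by
    have := (hmem b).2 hb
    rw [List.mem_cons] at this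
    exact this.resolve_left hab.symm
  obtain ⟨A, B, rfl⟩ := List.append_of_mem hb'
  exact ⟨A, B, h', hmem, hlen⟩

/-- A path off a longest cycle between two of its vertices is no longer than the arcs. -/
lemma IsCyc.length_le_of_via (h : IsCyc G a (A ++ b :: B))
    (hmax : ∀ c t, IsCyc G c t → t.length ≤ (A ++ b :: B).length) {l : List V} (hl : Via G a l b)
    (hn : l.Nodup) (hd : ∀ y ∈ l, y ∉ a :: (A ++ b :: B)) : l.length ≤ A.length := by
  by_contra hlt
  have h1 := h.via
  have h2 := h.nodup
  have h3 := h.two_le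
  rw [via_append] at h1
  have := hmax a (l ++ b :: B) ⟨via_append.2 ⟨hl, h1.2⟩, by grind, by simp at h3 ⊢; omega⟩
  simp at this
  omega

open Classical in
lemma IsCyc.add_two_mul_countP_le (h : IsCyc G a (A ++ b :: B))
    (hmax : ∀ c t, IsCyc G c t → t.length ≤ (A ++ b :: B).length)
    (h₁ : Via G a Y₁ x) (h₂ : Via G x Y₂ b) (hn : (Y₁ ++ x :: Y₂).Nodup)
    (hd : ∀ y ∈ Y₁ ++ x :: Y₂, y ∉ a :: (A ++ b :: B)) :
    (Y₁ ++ x :: Y₂).length + 2 * A.countP (G.Adj x) ≤ A.length := by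
  have h0 := h.length_le_of_via hmax (via_append.2 ⟨h₁, h₂⟩) hn hd
  have := List.add_two_mul_countP_le (P := G.Adj x) (L := A) (j := Y₁.length + 1)
    (k := Y₂.length + 1) (by simp at h0; omega) ?_ ?_
  · simp
    omega
  · rintro L₁ w L₂ rfl hw
    constructor
    · have hc : IsCyc G a (L₁ ++ w :: (L₂ ++ b :: B)) := by simpa using h
      have := hc.length_le_of_via (l := Y₁ ++ [x]) (by simpa using hmax) (by simp [h₁, hw])
        (by grind) (by grind)
      simpa using this
    · have hc : IsCyc G a (L₁ ++ w :: (L₂ ++ b :: B)) := by simpa using h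
      have hc' : IsCyc G w (L₂ ++ b :: (B ++ a :: L₁)) := by simpa using hc.rotate
      have hm : ∀ c t, IsCyc G c t → t.length ≤ (L₂ ++ b :: (B ++ a :: L₁)).length := by
        intro c t hct
        have := hmax c t hct
        simp at this ⊢
        omega
      have := hc'.length_le_of_via (l := x :: Y₂) hm (by simp [h₂, hw.symm])
        (List.nodup_append'.1 hn).2.1 fun y hy hy' => hd y (List.mem_append_right _ hy) (by
          simp only [List.mem_append, List.mem_cons] at hy' ⊢
          tauto)
      simpa using this
  · rintro L₁ u v L₂ rfl ⟨hu, hv⟩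
    have hc : IsCyc G a (L₁ ++ u :: (v :: (L₂ ++ b :: B))) := by simpa using h
    have hc' : IsCyc G u ([] ++ v :: (L₂ ++ b :: (B ++ a :: L₁))) := by simpa using hc.rotate
    have hm : ∀ c t, IsCyc G c t → t.length ≤ ([] ++ v :: (L₂ ++ b :: (B ++ a :: L₁))).length := by
      intro c t hct
      have := hmax c t hct
      simp at this ⊢
      omega
    have := hc'.length_le_of_via (l := [x]) hm (by simp [hu.symm, hv]) (by simp) (by
      have hx := hd x (by simp)
      simp only [List.mem_append, List.mem_cons, List.nil_append, List.not_mem_nil, or_false,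
        forall_eq] at hx ⊢
      tauto)
    simp at this

open Classical in
/-- If a vertex `x` off a longest cycle has degree at least `n/2`, then many of its neighbours lie
neither on that cycle nor on a given path through `x` between two vertices of the cycle. -/
lemma IsCyc.three_mul_length_le [Fintype V] (h : IsCyc G a (A ++ b :: B))
    (hmax : ∀ c t, IsCyc G c t → t.length ≤ (A ++ b :: B).length)
    (h₁ : Via G a Y₁ x) (h₂ : Via G x Y₂ b) (hn : (Y₁ ++ x :: Y₂).Nodup)
    (hd : ∀ y ∈ Y₁ ++ x :: Y₂, y ∉ a :: (A ++ b :: B))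
    (hx : Fintype.card V ≤ 2 * (Finset.univ.filter (G.Adj x)).card) :
    3 * (Y₁ ++ x :: Y₂).length ≤ (Finset.univ.filter fun y =>
        G.Adj x y ∧ y ∉ a :: (A ++ b :: B) ++ (Y₁ ++ x :: Y₂)).card + 2 +
      2 * Y₁.countP (G.Adj x) + 2 * Y₂.countP (G.Adj x) := by
  have hA := h.add_two_mul_countP_le hmax h₁ h₂ hn hd
  have hB := h.rotate.add_two_mul_countP_le (Y₁ := Y₂.reverse) (Y₂ := Y₁.reverse) (x := x)
    (fun c t hct => by
      have := hmax c t hct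
      simp at this ⊢
      omega) (via_reverse.2 h₂) (via_reverse.2 h₁) (by
      have := List.nodup_reverse.2 hn
      simpa using this) (by grind)
  have hnd : (a :: (A ++ b :: B) ++ (Y₁ ++ x :: Y₂)).Nodup :=
    List.nodup_append'.2 ⟨h.nodup, hn, fun y hy hy' => hd y hy' hy⟩
  set W := a :: (A ++ b :: B) ++ (Y₁ ++ x :: Y₂) with hW
  have h4 := card_filter_adj_eq_countP_add G x W hnd
  have h5 : (Finset.univ.filter fun y => G.Adj x y ∧ y ∉ W).card + W.length ≤ Fintype.card V := by
    rw [← List.toFinset_card_of_nodup hnd, ← Finset.card_union_of_disjoint]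
    · exact Finset.card_le_univ _
    · rw [Finset.disjoint_left]
      intro y hy
      simp only [Finset.mem_filter] at hy
      rw [List.mem_toFinset]
      exact hy.2.2
  have h6 : W.countP (G.Adj x) ≤ 2 + A.countP (G.Adj x) + B.countP (G.Adj x) +
      Y₁.countP (G.Adj x) + Y₂.countP (G.Adj x) := by
    simp only [hW, List.countP_append, List.countP_cons, SimpleGraph.irrefl, decide_false,
      Bool.false_eq_true, if_false]
    split_ifs <;> omega
  have h7 : W.length = 2 + A.length + B.length + (Y₁ ++ x :: Y₂).length := by
    simp [hW]
    omega
  simp only [List.length_append, List.length_cons, List.length_reverse] at hA hB h7 ⊢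
  omega

end Arcs

section Ears

variable {V : Type*} {G : SimpleGraph V} {S : Set V} {a b x w : V} {l Y₁ Y₂ F : List V}

/-- The list `l` is the interior of a path from `a` to `b` meeting `S` in its two ends only. -/
structure IsEar (G : SimpleGraph V) (S : Set V) (a : V) (l : List V) (b : V) : Prop where
  left_mem : a ∈ S
  right_mem : b ∈ S
  ne : a ≠ b
  via : Via G a l b
  nodup : l.Nodup
  notMem : ∀ y ∈ l, y ∉ S

/-- The list `F` is the interior of a path from `x` to `w` that leaves the ear `Y₁ ++ x :: Y₂` of
`S` at `x` and returns to the ear or to `S` at `w`. -/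
structure IsBranch (G : SimpleGraph V) (S : Set V) (Y₁ : List V) (x : V) (Y₂ F : List V) (w : V) :
    Prop where
  via : Via G x F w
  nodup : F.Nodup
  notMem : ∀ y ∈ F, y ∉ S ∧ y ≠ x ∧ y ∉ Y₁ ∧ y ∉ Y₂
  mem : w ∈ S ∨ w ∈ Y₁ ∨ w ∈ Y₂

lemma IsEar.symm (h : IsEar G S a (Y₁ ++ x :: Y₂) b) :
    IsEar G S b (Y₂.reverse ++ x :: Y₁.reverse) a := by
  have e : Y₂.reverse ++ x :: Y₁.reverse = (Y₁ ++ x :: Y₂).reverse := by simp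
  rw [e]
  exact ⟨h.right_mem, h.left_mem, h.ne.symm, via_reverse.2 h.via, List.nodup_reverse.2 h.nodup,
    fun y hy => h.notMem y (List.mem_reverse.1 hy)⟩

lemma IsBranch.symm (h : IsBranch G S Y₁ x Y₂ F w) :
    IsBranch G S Y₂.reverse x Y₁.reverse F w :=
  ⟨h.via, h.nodup, fun y hy => by have := h.notMem y hy; simp; tauto, by
    have := h.mem; simp; tauto⟩

lemma IsBranch.exists_isEar (hF : IsBranch G S Y₁ x Y₂ F w)
    (hE : IsEar G S a (Y₁ ++ x :: Y₂) b) :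
    ∃ a' l b', IsEar G S a' l b' ∧ x ∈ l ∧ ∀ y ∈ F, y ∈ l := by
  obtain ⟨ha, hb, hab, hv, hn, hd⟩ := hE
  obtain ⟨fv, fn, fd, fm⟩ := hF
  rw [via_append] at hv
  rcases fm with hw | hw | hw
  · by_cases hwb : w = b
    · subst hwb
      exact ⟨a, Y₁ ++ x :: F, w, ⟨ha, hb, hab, via_append.2 ⟨hv.1, fv⟩, by grind, by grind⟩,
        by simp, by simp +contextual⟩
    · exact ⟨w, F.reverse ++ x :: Y₂, b, ⟨hw, hb, hwb, via_append.2 ⟨via_reverse.2 fv, hv.2⟩,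
        by grind, by grind⟩, by simp, by simp +contextual⟩
  · obtain ⟨L₁, L₂, rfl⟩ := List.append_of_mem hw
    refine ⟨a, L₁ ++ w :: (F.reverse ++ x :: Y₂), b, ⟨ha, hb, hab, ?_, ?_, by grind⟩,
      by simp, by simp +contextual⟩
    · simp only [via_append] at hv ⊢
      exact ⟨hv.1.1, via_reverse.2 fv, hv.2⟩
    · simp only [List.nodup_append', List.nodup_cons, List.nodup_reverse, List.disjoint_left,
        List.mem_append, List.mem_cons, List.mem_reverse, not_or] at hn fd ⊢
      grind
  · obtain ⟨L₁, L₂, rfl⟩ := List.append_of_mem hw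
    refine ⟨a, Y₁ ++ x :: (F ++ w :: L₂), b, ⟨ha, hb, hab, ?_, by grind, by grind⟩,
      by simp, by simp +contextual⟩
    simp only [via_append] at hv ⊢
    exact ⟨hv.1, fv, hv.2.2⟩

/-- In a 2-connected graph every vertex off `S` lies on an ear of `S`. -/
lemma PathsAvoid.exists_isEar (hG : PathsAvoid G) (hS : S.Nontrivial) (hx : x ∉ S) :
    ∃ a l b, IsEar G S a l b ∧ x ∈ l := by
  set D : Set V := {y | y ∈ S ∨ ∃ a l b, IsEar G S a l b ∧ y ∈ l} with hD
  by_contra hcon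
  have hxD : x ∉ D := fun h => h.elim hx hcon
  obtain ⟨s, hs, t, ht, hst⟩ := hS
  obtain ⟨m, l, w, hm, hw, -, hv, -, hl⟩ := hG.exists_via (M := Dᶜ) (S := D) (t := t) ⟨x, hxD⟩
    (fun h => h (Or.inl ht)) (fun y hy => hy) ⟨s, Or.inl hs, hst⟩
  cases l with
  | cons y l => exact absurd (hl y (by simp)).2.1 (hl y (by simp)).1
  | nil =>
    rw [via_nil] at hv
    have hmS : m ∉ S := fun h => hm (Or.inl h)
    have hmw : m ≠ w := hv.ne
    rcases hw with hw | ⟨a, l, b, hE, hwl⟩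
    · obtain ⟨m', l, w', hm', hw', hww', hv', hn', hl'⟩ := hG.exists_via (M := {m}) (S := S)
        (t := w) ⟨m, rfl⟩ (fun h => hmw h.symm) (by rintro y rfl; exact hmS) (by
          by_cases hsw : s = w
          · exact ⟨t, ht, fun h => hst (hsw.trans h.symm)⟩
          · exact ⟨s, hs, hsw⟩)
      obtain rfl : m' = m := hm'
      refine hm (Or.inr ⟨w, m' :: l, w', ⟨hw, hw', hww'.symm, via_cons.2 ⟨hv.symm, hv'⟩, ?_, ?_⟩,
        by simp⟩)
      · exact List.nodup_cons.2 ⟨fun h => (hl' m' h).1 rfl, hn'⟩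
      · intro y hy
        rcases List.mem_cons.1 hy with rfl | hy
        · exact hmS
        · exact (hl' y hy).2.1
    · obtain ⟨Y₁, Y₂, rfl⟩ := List.append_of_mem hwl
      have hmY : m ∉ Y₁ ++ w :: Y₂ := fun h => hm (Or.inr ⟨a, _, b, hE, h⟩)
      obtain ⟨m', l, w', hm', hw', hww', hv', hn', hl'⟩ := hG.exists_via (M := {m})
        (S := S ∪ {y | y ∈ Y₁ ++ w :: Y₂}) (t := w) ⟨m, rfl⟩ (fun h => hmw h.symm)
        (by rintro y rfl; simp [hmS]; simpa using hmY)
        ⟨a, Or.inl hE.left_mem, fun h => hE.notMem w (by simp) (h ▸ hE.left_mem)⟩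
      obtain rfl : m' = m := hm'
      have hB : IsBranch G S Y₁ w Y₂ (m' :: l) w' := by
        refine ⟨via_cons.2 ⟨hv.symm, hv'⟩, List.nodup_cons.2 ⟨fun h => (hl' m' h).1 rfl, hn'⟩,
          fun y hy => ?_, ?_⟩
        · rcases List.mem_cons.1 hy with rfl | hy
          · simp only [List.mem_append, List.mem_cons, not_or] at hmY
            exact ⟨hmS, hmY.2.1, hmY.1, hmY.2.2⟩
          · have := hl' y hy
            simp only [Set.mem_union, Set.mem_ofPred_eq, List.mem_append, List.mem_cons,
              not_or] at this
            tauto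
        · simp only [Set.mem_union, Set.mem_ofPred_eq, List.mem_append, List.mem_cons] at hw'
          tauto
      obtain ⟨a', l', b', hE', -, hF'⟩ := hB.exists_isEar hE
      exact hm (Or.inr ⟨a', l', b', hE', hF' m' (by simp)⟩)

end Ears

section LongestEar

variable {V : Type*} {G : SimpleGraph V} {S : Set V} {a b e f x w : V} {l Y₁ Y₂ F P L : List V}

lemma Via.exists_first (h : Via G x Y₂ b) :
    ∃ e ∈ b :: Y₂, ∀ v l, Via G v (l ++ Y₂) b ↔ Via G v l e := by
  cases Y₂ with
  | nil => exact ⟨b, by simp, by simp⟩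
  | cons y Y =>
    rw [via_cons] at h
    exact ⟨y, by simp, fun v l => by rw [via_append, and_iff_left h.2]⟩

lemma Via.exists_last (h : Via G a Y₁ x) :
    ∃ e ∈ a :: Y₁, ∀ l v, Via G a (Y₁ ++ l) v ↔ Via G e l v := by
  obtain ⟨e, he, h'⟩ := (via_reverse.2 h).exists_first
  refine ⟨e, by simpa using he, fun l v => ?_⟩
  rw [← via_reverse, List.reverse_append, h', via_reverse]

/-- An ear `Y₁ ++ x :: Y₂` of `S` that is longest among the ears through `x`. -/
structure IsLongestEar (G : SimpleGraph V) (S : Set V) (a : V) (Y₁ : List V) (x : V)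
    (Y₂ : List V) (b : V) : Prop where
  isEar : IsEar G S a (Y₁ ++ x :: Y₂) b
  length_le : ∀ a' l b', IsEar G S a' l b' → x ∈ l → l.length ≤ (Y₁ ++ x :: Y₂).length

lemma IsLongestEar.symm (h : IsLongestEar G S a Y₁ x Y₂ b) :
    IsLongestEar G S b Y₂.reverse x Y₁.reverse a :=
  ⟨h.isEar.symm, fun a' l b' hl hx => by
    have := h.length_le a' l b' hl hx
    simp at this ⊢
    omega⟩

lemma IsLongestEar.not_adj_last (h : IsLongestEar G S a Y₁ x Y₂ b)
    (he : ∀ l v, Via G a (Y₁ ++ l) v ↔ Via G e l v) {z : V} (hz : G.Adj x z) (hzS : z ∉ S)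
    (hz₁ : z ∉ Y₁) (hz₂ : z ∉ Y₂) : ¬ G.Adj e z := by
  intro hez
  obtain ⟨ha, hb, hab, hv, hn, hd⟩ := h.isEar
  have hzx := hz.ne
  have := h.length_le a (Y₁ ++ z :: x :: Y₂) b ⟨ha, hb, hab, ?_, by grind, by grind⟩ (by simp)
  · simp at this
  · rw [he, via_cons, via_cons]
    exact ⟨hez, hz.symm, (via_append.1 hv).2⟩

lemma IsLongestEar.not_adj_first (h : IsLongestEar G S a Y₁ x Y₂ b)
    (he : ∀ v l, Via G v (l ++ Y₂) b ↔ Via G v l e) {z : V} (hz : G.Adj x z) (hzS : z ∉ S)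
    (hz₁ : z ∉ Y₁) (hz₂ : z ∉ Y₂) : ¬ G.Adj e z := by
  refine h.symm.not_adj_last (fun l v => ?_) hz hzS (by simpa) (by simpa)
  rw [← via_reverse, List.reverse_append, List.reverse_reverse, he, via_reverse]

lemma IsLongestEar.length_lt (h : IsLongestEar G S a Y₁ x Y₂ b) (hF : IsBranch G S Y₁ x Y₂ F w) :
    F.length + 1 ≤ (Y₁ ++ x :: Y₂).length := by
  obtain ⟨a', l, b', hl, hx, hFl⟩ := hF.exists_isEar h.isEar
  have hn : (x :: F).Nodup := List.nodup_cons.2 ⟨fun hx => (hF.notMem x hx).2.1 rfl, hF.nodup⟩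
  have := (List.subperm_of_subset hn (List.cons_subset.2 ⟨hx, hFl⟩)).length_le
  exact this.trans (h.length_le _ _ _ hl hx)

lemma IsLongestEar.length_le_right (h : IsLongestEar G S a Y₁ x Y₂ b)
    (hF : IsBranch G S Y₁ x Y₂ F w) (hw : w ∈ S) (hwa : w ≠ a) : F.length ≤ Y₂.length := by
  obtain ⟨ha, hb, hab, hv, hn, hd⟩ := h.isEar
  obtain ⟨fv, fn, fd, fm⟩ := hF
  have := h.length_le a (Y₁ ++ x :: F) w ⟨ha, hw, hwa.symm,
    via_append.2 ⟨(via_append.1 hv).1, fv⟩, by grind, by grind⟩ (by simp)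
  simpa using this

lemma IsLongestEar.length_le_left (h : IsLongestEar G S a Y₁ x Y₂ b)
    (hF : IsBranch G S Y₁ x Y₂ F w) (hw : w ∈ S) (hwb : w ≠ b) : F.length ≤ Y₁.length := by
  simpa using h.symm.length_le_right hF.symm hw hwb

open Classical in
lemma IsLongestEar.length_add_countP_le_aux (h : IsLongestEar G S a (P ++ L) x Y₂ b)
    (hF : IsBranch G S (P ++ L) x Y₂ F w) (hby : Via G a (P ++ L ++ Y₂) b)
    (hP : ∀ l v, Via G a (P ++ l) v ↔ Via G w l v) :
    F.length + L.countP (G.Adj x) ≤ L.length := by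
  obtain ⟨ha, hb, hab, hv, hn, hd⟩ := h.isEar
  obtain ⟨fv, fn, fd, fm⟩ := hF
  have hv₂ := (via_append.1 hv).2
  have fv' := via_reverse.2 fv
  refine List.add_countP_le_length ?_ ?_
  · have := h.length_le a (P ++ (F.reverse ++ x :: Y₂)) b ⟨ha, hb, hab,
      by rw [hP]; exact via_append.2 ⟨fv', hv₂⟩, ?_, by grind⟩ (by simp)
    · simp at this
      omega
    · simp only [List.nodup_append', List.nodup_cons, List.nodup_reverse, List.disjoint_left,
        List.mem_append, List.mem_cons, List.mem_reverse, not_or] at hn fd ⊢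
      grind
  · rintro N₁ c N₂ rfl hc
    have := h.length_le a (P ++ (F.reverse ++ x :: c :: (N₂ ++ Y₂))) b ⟨ha, hb, hab, ?_, ?_, ?_⟩
      (by simp)
    · simp at this
      omega
    · have e : P ++ (N₁ ++ c :: N₂) ++ Y₂ = (P ++ N₁) ++ c :: (N₂ ++ Y₂) := by simp
      rw [e, via_append] at hby
      rw [hP, via_append, via_cons]
      exact ⟨fv', by simpa using hc, hby.2⟩
    · simp only [List.nodup_append', List.nodup_cons, List.nodup_reverse, List.disjoint_left,
        List.mem_append, List.mem_cons, List.mem_reverse, not_or] at hn fd ⊢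
      clear fv fv' hv₂ hv hby hP h
      grind
    · intro y hy
      simp only [List.mem_append, List.mem_cons, List.mem_reverse] at hy hd
      clear fv fv' hv₂ hv hby hP h
      grind

open Classical in
lemma IsLongestEar.length_add_countP_le_left (h : IsLongestEar G S a Y₁ x Y₂ b)
    (hF : IsBranch G S Y₁ x Y₂ F w) (hby : Via G a (Y₁ ++ Y₂) b) (hw : w ∈ a :: Y₁) :
    F.length + Y₁.countP (G.Adj x) ≤ Y₁.length := by
  rcases List.mem_cons.1 hw with rfl | hw
  · exact IsLongestEar.length_add_countP_le_aux (P := []) h hF hby (by simp)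
  · obtain ⟨L₁, L₂, rfl⟩ := List.append_of_mem hw
    have e : L₁ ++ w :: L₂ = (L₁ ++ [w]) ++ L₂ := by simp
    have hv := (via_append.1 (via_append.1 h.isEar.via).1).1
    rw [e] at h hF hby ⊢
    have := h.length_add_countP_le_aux hF hby (fun l v => by simp [hv])
    have := (L₁ ++ [w]).countP_le_length (p := fun y => G.Adj x y)
    rw [List.countP_append, List.length_append]
    omega

open Classical in
lemma IsLongestEar.length_add_countP_le_right (h : IsLongestEar G S a Y₁ x Y₂ b)
    (hF : IsBranch G S Y₁ x Y₂ F w) (hby : Via G a (Y₁ ++ Y₂) b) (hw : w ∈ b :: Y₂) :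
    F.length + Y₂.countP (G.Adj x) ≤ Y₂.length := by
  have := h.symm.length_add_countP_le_left hF.symm
    (by rw [← List.reverse_append]; exact via_reverse.2 hby) (by simpa using hw)
  simpa using this

open Classical in
/-- A nonempty clique of neighbours of `x` off an ear extends to a branch of the ear. -/
lemma PathsAvoid.exists_isBranch (hG : PathsAvoid G) (hE : IsEar G S a (Y₁ ++ x :: Y₂) b)
    {M : Finset V} (hM : M.Nonempty) (hadj : ∀ y ∈ M, G.Adj x y)
    (hMS : ∀ y ∈ M, y ∉ S ∧ y ∉ Y₁ ∧ y ∉ Y₂)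
    (hcl : ∀ y ∈ M, ∀ z ∈ M, y ≠ z → G.Adj y z) :
    ∃ F w, IsBranch G S Y₁ x Y₂ F w ∧ M.card ≤ F.length := by
  obtain ⟨m, l, w, hm, hw, hwx, hv, hn, hl⟩ := hG.exists_via (M := M)
    (S := {y | y ∈ S ∨ y ∈ Y₁ ∨ y ∈ Y₂}) (t := x) hM (fun hx => (hadj x hx).ne rfl)
    (fun y hy hy' => by have := hMS y hy; simp at hy'; tauto)
    ⟨a, Or.inl hE.left_mem, fun h => hE.notMem x (by simp) (h ▸ hE.left_mem)⟩
  have hmM : m ∈ M := hm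
  refine ⟨(M.erase m).toList ++ m :: l, w, ⟨via_append.2 ⟨?_, hv⟩, ?_, ?_, hw⟩, ?_⟩
  · refine Via.of_pairwise (List.pairwise_cons.2 ⟨fun y hy => hadj y ?_, ?_⟩)
    · simp at hy
      rcases hy with hy | rfl
      · exact hy.2
      · exact hmM
    · refine List.Nodup.pairwise_of_forall_ne ?_ ?_
      · simp [List.nodup_append', Finset.nodup_toList]
      · intro y hy z hz hyz
        refine hcl y ?_ z ?_ hyz
        · simp at hy
          rcases hy with hy | rfl
          · exact hy.2
          · exact hmM
        · simp at hz
          rcases hz with hz | rfl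
          · exact hz.2
          · exact hmM
  · refine List.nodup_append'.2 ⟨Finset.nodup_toList _,
      List.nodup_cons.2 ⟨fun h => (hl m h).1 hm, hn⟩, fun y hy hy' => ?_⟩
    rw [Finset.mem_toList, Finset.mem_erase] at hy
    rcases List.mem_cons.1 hy' with rfl | hy'
    · exact hy.1 rfl
    · exact (hl y hy').1 hy.2
  · intro y hy
    have hM' : y ∈ M → y ∉ S ∧ y ≠ x ∧ y ∉ Y₁ ∧ y ∉ Y₂ := fun hy =>
      ⟨(hMS y hy).1, (hadj y hy).ne', (hMS y hy).2⟩
    rw [List.mem_append, List.mem_cons, Finset.mem_toList, Finset.mem_erase] at hy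
    rcases hy with hy | rfl | hy
    · exact hM' hy.2
    · exact hM' hmM
    · have := hl y hy
      simp only [Set.mem_ofPred_eq, not_or] at this
      tauto
  · have := Finset.card_erase_add_one hmM
    simp
    omega

end LongestEar

section Main

variable {V : Type*} [Fintype V] {G : SimpleGraph V} {a b c x : V} {A B t Y₁ Y₂ : List V}

lemma PathsAvoid.exists_isLongestEar {S : Set V} (hG : PathsAvoid G) (hS : S.Nontrivial)
    (hx : x ∉ S) : ∃ a Y₁ Y₂ b, IsLongestEar G S a Y₁ x Y₂ b := by
  obtain ⟨a₀, l₀, b₀, h₀, hx₀⟩ := hG.exists_isEar hS hx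
  obtain ⟨m, ⟨a, l, b, hl, hxl, rfl⟩, hmax⟩ :=
    exists_max_nat (P := fun k => ∃ a l b, IsEar G S a l b ∧ x ∈ l ∧ l.length = k)
      ⟨_, a₀, l₀, b₀, h₀, hx₀, rfl⟩ (Fintype.card V) (by
        rintro k ⟨a, l, b, hl, -, rfl⟩
        exact hl.nodup.length_le_card)
  obtain ⟨Y₁, Y₂, rfl⟩ := List.append_of_mem hxl
  exact ⟨a, Y₁, Y₂, b, hl, fun a' l b' hl hx => hmax _ ⟨a', l, b', hl, hx, rfl⟩⟩

open Classical in
lemma IsLongestEar.exists_isInducedK14 {S : Set V} (hG : PathsAvoid G)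
    (h : IsLongestEar G S a Y₁ x Y₂ b)
    (hcard : 3 * (Y₁ ++ x :: Y₂).length ≤
      (Finset.univ.filter fun y => G.Adj x y ∧ y ∉ S ∧ y ∉ Y₁ ∧ y ∉ Y₂).card + 2 +
        2 * Y₁.countP (G.Adj x) + 2 * Y₂.countP (G.Adj x)) :
    ∃ p q r s, IsInducedK14 G x p q r s := by
  by_contra! hind
  set Z := Finset.univ.filter fun y => G.Adj x y ∧ y ∉ S ∧ y ∉ Y₁ ∧ y ∉ Y₂ with hZ
  have hmZ : ∀ y, y ∈ Z ↔ G.Adj x y ∧ y ∉ S ∧ y ∉ Y₁ ∧ y ∉ Y₂ := by simp [hZ]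
  have hc₁ := Y₁.countP_le_length (p := fun y => G.Adj x y)
  have hc₂ := Y₂.countP_le_length (p := fun y => G.Adj x y)
  rw [List.length_append, List.length_cons] at hcard
  obtain ⟨hv₁, hv₂⟩ := via_append.1 h.isEar.via
  obtain ⟨e, hem, he⟩ := hv₁.exists_last
  obtain ⟨f, hfm, hf⟩ := hv₂.exists_first
  have hxe : G.Adj x e := by
    have := he [] x
    rw [List.append_nil, via_nil] at this
    exact (this.1 hv₁).symm
  have hxf : G.Adj x f := by
    have := hf x []
    rw [List.nil_append, via_nil] at this
    exact this.1 hv₂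
  have heZ : ∀ z ∈ Z, ¬ G.Adj e z ∧ e ≠ z := by
    intro z hz
    rw [hmZ] at hz
    refine ⟨h.not_adj_last he hz.1 hz.2.1 hz.2.2.1 hz.2.2.2, ?_⟩
    rintro rfl
    rcases List.mem_cons.1 hem with rfl | hem
    · exact hz.2.1 h.isEar.left_mem
    · exact hz.2.2.1 hem
  have hfZ : ∀ z ∈ Z, ¬ G.Adj f z ∧ f ≠ z := by
    intro z hz
    rw [hmZ] at hz
    refine ⟨h.not_adj_first hf hz.1 hz.2.1 hz.2.2.1 hz.2.2.2, ?_⟩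
    rintro rfl
    rcases List.mem_cons.1 hfm with rfl | hfm
    · exact hz.2.1 h.isEar.right_mem
    · exact hz.2.2.2 hfm
  have hef : e ≠ f := by
    rintro rfl
    have hn := h.isEar.nodup
    have hd := h.isEar.notMem
    have hab := h.isEar.ne
    have ha := h.isEar.left_mem
    have hb := h.isEar.right_mem
    clear * - hn hd hem hfm hab ha hb
    grind
  obtain ⟨z, hz⟩ : Z.Nonempty := Finset.card_pos.1 (by omega)
  have hbr : ∀ M ⊆ Z, M.Nonempty → (∀ y ∈ M, ∀ z ∈ M, y ≠ z → G.Adj y z) →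
      ∃ F w, IsBranch G S Y₁ x Y₂ F w ∧ M.card ≤ F.length := fun M hMZ hM hcl =>
    hG.exists_isBranch h.isEar hM (fun y hy => ((hmZ y).1 (hMZ hy)).1)
      (fun y hy => ((hmZ y).1 (hMZ hy)).2) hcl
  obtain ⟨k, ⟨F, w, hF, rfl⟩, hFmax⟩ :=
    exists_max_nat (P := fun k => ∃ F w, IsBranch G S Y₁ x Y₂ F w ∧ F.length = k)
      (by
        obtain ⟨F, w, hF, -⟩ := hbr {z} (by simpa using hz) (by simp) (by simp)
        exact ⟨_, F, w, hF, rfl⟩) (Fintype.card V) (by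
        rintro k ⟨F, w, hF, rfl⟩
        exact hF.nodup.length_le_card)
  have hlt := h.length_lt hF
  rw [List.length_append, List.length_cons] at hlt
  have hclique : ∀ M ⊆ Z, (∀ y ∈ M, ∀ z ∈ M, y ≠ z → G.Adj y z) → M.card ≤ F.length := by
    intro M hMZ hcl
    rcases M.eq_empty_or_nonempty with rfl | hM
    · simp
    · obtain ⟨F', w', hF', hle⟩ := hbr M hMZ hM hcl
      exact hle.trans (hFmax _ ⟨F', w', hF', rfl⟩)
  have hone := hclique {z} (by simpa using hz) (by simp)
  obtain ⟨g, F, rfl⟩ : ∃ g F', F = g :: F' := by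
    cases F with
    | nil => simp at hone
    | cons g F' => exact ⟨g, F', rfl⟩
  have hxg : G.Adj x g := (via_cons.1 hF.via).1
  have hgZ : g ∈ Z := by
    have := hF.notMem g (by simp)
    rw [hmZ]
    tauto
  have hgM : ∀ m ∈ Z, m ∉ g :: F → ¬ G.Adj g m ∧ g ≠ m := by
    intro m hm hmF
    refine ⟨fun hgm => ?_, fun hgm => hmF (by simp [hgm])⟩
    rw [hmZ] at hm
    have := hFmax _ ⟨m :: g :: F, w, ⟨?_, List.nodup_cons.2 ⟨hmF, hF.nodup⟩, ?_, hF.mem⟩, rfl⟩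
    · simp at this
    · rw [via_cons, via_cons]
      exact ⟨hm.1, hgm.symm, (via_cons.1 hF.via).2⟩
    · intro y hy
      rcases List.mem_cons.1 hy with rfl | hy
      · exact ⟨hm.2.1, hm.1.ne', hm.2.2⟩
      · exact hF.notMem y hy
  set M := Z.filter (· ∉ g :: F) with hM
  have hZM : Z.card ≤ (g :: F).length + M.card := by
    have : Z ⊆ (g :: F).toFinset ∪ M := by
      intro y hy
      rw [Finset.mem_union, List.mem_toFinset, hM, Finset.mem_filter]
      tauto
    have h₁ := Finset.card_le_card this
    have h₂ := Finset.card_union_le (g :: F).toFinset M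
    have h₃ := (g :: F).toFinset_card_le
    omega
  by_cases hadj : G.Adj e f
  · have hby : Via G a (Y₁ ++ Y₂) b := by
      rw [he, ← List.nil_append Y₂, hf, via_nil]
      exact hadj
    have hMF : M.card ≤ (g :: F).length := by
      refine hclique M (Finset.filter_subset _ _) fun y hy z hz hyz => ?_
      rw [hM, Finset.mem_filter] at hy hz
      by_contra hyz'
      have hgy := hgM y hy.1 hy.2
      have hgz := hgM z hz.1 hz.2
      exact hind e g y z ⟨(heZ g hgZ).2, (heZ y hy.1).2, (heZ z hz.1).2, hgy.2, hgz.2, hyz,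
        hxe, hxg, ((hmZ y).1 hy.1).1, ((hmZ z).1 hz.1).1, (heZ g hgZ).1, (heZ y hy.1).1,
        (heZ z hz.1).1, hgy.1, hgz.1, hyz'⟩
    by_cases hw₁ : w ∈ a :: Y₁
    · have := h.length_add_countP_le_left hF hby hw₁
      omega
    by_cases hw₂ : w ∈ b :: Y₂
    · have := h.length_add_countP_le_right hF hby hw₂
      omega
    rw [List.mem_cons, not_or] at hw₁ hw₂
    have hwS : w ∈ S := hF.mem.resolve_right (by tauto)
    have := h.length_le_left hF hwS hw₂.1
    have := h.length_le_right hF hwS hw₁.1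
    omega
  · have hMe : M = ∅ := by
      refine Finset.eq_empty_of_forall_notMem fun m hm => ?_
      rw [hM, Finset.mem_filter] at hm
      have hgm := hgM m hm.1 hm.2
      exact hind e f g m ⟨hef, (heZ g hgZ).2, (heZ m hm.1).2, (hfZ g hgZ).2, (hfZ m hm.1).2,
        hgm.2, hxe, hxf, hxg, ((hmZ m).1 hm.1).1, hadj, (heZ g hgZ).1, (heZ m hm.1).1,
        (hfZ g hgZ).1, (hfZ m hm.1).1, hgm.1⟩
    rw [hMe, Finset.card_empty] at hZM
    omega

open Classical in
/-- A vertex of degree at least `n/2` off a longest cycle of a 2-connected graph is the center of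
an induced `K_{1,4}`. -/
lemma PathsAvoid.exists_isInducedK14 (hG : PathsAvoid G) (h : IsCyc G c t)
    (hmax : ∀ c' t', IsCyc G c' t' → t'.length ≤ t.length) (hx : x ∉ c :: t)
    (hdeg : Fintype.card V ≤ 2 * (Finset.univ.filter (G.Adj x)).card) :
    ∃ p q r s, IsInducedK14 G x p q r s := by
  obtain ⟨S, hS⟩ : ∃ S : Set V, ∀ y, y ∈ S ↔ y ∈ c :: t := ⟨{y | y ∈ c :: t}, fun _ => Iff.rfl⟩
  have hSn : S.Nontrivial := by
    have h₁ := h.two_le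
    have h₂ := h.nodup
    cases t with
    | nil => simp at h₁
    | cons d t =>
      refine ⟨c, by simp [hS], d, by simp [hS], ?_⟩
      rintro rfl
      simp at h₂
  obtain ⟨a, Y₁, Y₂, b, hE⟩ := hG.exists_isLongestEar hSn (mt (hS x).1 hx)
  obtain ⟨ha, hb, hab, hv, hn, hd⟩ := hE.isEar
  obtain ⟨A, B, hc, hmem, hlen⟩ := h.exists_eq_append ((hS a).1 ha) ((hS b).1 hb) hab
  obtain ⟨hv₁, hv₂⟩ := via_append.1 hv
  have := hc.three_mul_length_le (by rwa [hlen]) hv₁ hv₂ hn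
    (fun y hy hy' => hd y hy ((hS y).2 ((hmem y).1 hy'))) hdeg
  refine hE.exists_isInducedK14 hG (this.trans ?_)
  refine Nat.add_le_add_right (Nat.add_le_add_right (Nat.add_le_add_right
    (Finset.card_le_card fun y hy => ?_) _) _) _
  rw [Finset.mem_filter, List.mem_append, hmem, ← hS, List.mem_append, List.mem_cons] at hy
  rw [Finset.mem_filter]
  tauto

end Main

/-- **Li's lemma.** In a 2-connected `K_{1,4}`-o-heavy graph, every longest cycle
contains all vertices of degree at least `n/2`. -/
theorem li_longest_cycle_heavy {V : Type*} [Fintype V] [DecidableEq V]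
    (G : SimpleGraph V) [DecidableRel G.Adj]
    (h2 : TwoConnected G)
    (hheavy : K14OHeavy G)
    (v : V) (C : G.Walk v v) (hC : C.IsCycle)
    (hlongest : ∀ (u : V) (C' : G.Walk u u), C'.IsCycle → C'.length ≤ C.length) :
    ∀ x : V, Fintype.card V ≤ 2 * G.degree x → x ∈ C.support := by
  classical
  intro x hx
  by_contra hxC
  have hdeg : ∀ y, G.degree y = (Finset.univ.filter (G.Adj y)).card := fun y => by
    rw [← SimpleGraph.card_neighborFinset_eq_degree, SimpleGraph.neighborFinset_eq_filter]
  obtain ⟨c, t, h, hlen, hmem⟩ := exists_isCyc_of_isCycle C hC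
  let G₁ : SimpleGraph V :=
    { Adj := fun u w => G.Adj u w ∨
        (u ≠ w ∧ u ≠ x ∧ w ≠ x ∧ Fintype.card V ≤ G.degree u + G.degree w)
      symm := ⟨fun u w h => h.imp (fun h => h.symm) fun h => ⟨h.1.symm, h.2.2.1, h.2.1, by omega⟩⟩
      loopless := ⟨fun u h => h.elim (fun h => h.ne rfl) fun h => h.1 rfl⟩ }
  have hle : G ≤ G₁ := fun _ _ => Or.inl
  have hadj : ∀ y, G₁.Adj x y ↔ G.Adj x y := fun y =>
    ⟨fun h => h.resolve_right fun h => h.2.1 rfl, Or.inl⟩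
  have h₁ : IsCyc G₁ c t := ⟨h.via.mono hle, h.nodup, h.two_le⟩
  have hmax : ∀ c' t', IsCyc G₁ c' t' → t'.length ≤ t.length := by
    intro c' t' h'
    obtain ⟨c'', t'', h'', hle'⟩ := IsCyc.exists_of_le_degree_add hle
      (fun a b hab => hab.imp_right fun hab => by
        have := hab.2.2.2
        rw [hdeg, hdeg] at this
        convert this) h'
    obtain ⟨C', hC', hlen'⟩ := h''.exists_isCycle
    have := hlongest _ C' hC'
    omega
  have hG₁ : PathsAvoid G₁ := fun t u v hu hv huv => by
    obtain ⟨l, hl, hl'⟩ := pathsAvoid_of_connected h2.2 t u v hu hv huv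
    exact ⟨l, hl.mono hle, hl'⟩
  obtain ⟨p, q, r, s, hpq, hpr, hps, hqr, hqs, hrs, hp, hq, hr, hs, npq, npr, nps, nqr, nqs, nrs⟩ :=
    hG₁.exists_isInducedK14 h₁ hmax (fun hx => hxC ((hmem x).1 hx)) (by
      simp only [hadj]
      rwa [hdeg] at hx)
  obtain ⟨u, w, hu, hw, huw, nuw, hd⟩ := hheavy x p q r s ⟨hpq, hpr, hps, hqr, hqs, hrs,
    (hadj p).1 hp, (hadj q).1 hq, (hadj r).1 hr, (hadj s).1 hs, fun h => npq (hle h),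
    fun h => npr (hle h), fun h => nps (hle h), fun h => nqr (hle h), fun h => nqs (hle h),
    fun h => nrs (hle h)⟩
  have hleaf : ∀ y ∈ ({x, p, q, r, s} : Set V), y ≠ x →
      y = p ∨ y = q ∨ y = r ∨ y = s := fun y hy hyx => by simpa [hyx] using hy
  have hcenter : ∀ y ∈ ({x, p, q, r, s} : Set V), y ≠ x → G.Adj x y := by
    intro y hy hyx
    rw [← hadj]
    rcases hleaf y hy hyx with rfl | rfl | rfl | rfl <;> assumption
  have hux : u ≠ x := fun hux => nuw (hux ▸ hcenter w hw (hux ▸ huw.symm))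
  have hwx : w ≠ x := fun hwx => nuw (hwx ▸ (hcenter u hu hux).symm)
  have huw₁ : G₁.Adj u w := Or.inr ⟨huw, hux, hwx, hd⟩
  rcases hleaf u hu hux with rfl | rfl | rfl | rfl <;>
    rcases hleaf w hw hwx with rfl | rfl | rfl | rfl <;>
    first
    | exact huw rfl
    | contradiction
    | exact absurd huw₁.symm (by assumption)
end

section
/- Let G be a non-Hamiltonian graph on n vertices, C a longest cycle of G with a fixed orientation, R a component of G − V(C), and A the set of neighbors of R on C. Then for all v_i, v_j ∈ A with v_i ≠ v_j, neither {v_i⁻, v_j⁻} nor {v_i⁺, v_j⁺} belongs to Ẽ(G). -/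
open SimpleGraph

/-- `{x, y}` is an Ore-edge of `G`: either an actual edge, or a pair of distinct
vertices with degree sum at least `n`. -/
def OreEdge {V : Type*} [Fintype V] (G : SimpleGraph V) [DecidableRel G.Adj]
    (x y : V) : Prop :=
  x ≠ y ∧ (G.Adj x y ∨ Fintype.card V ≤ G.degree x + G.degree y)

/-- The cycle `C = f 0, f 1, …, f (m-1), f 0` in `G`, with the orientation given
by increasing indices (so `f (i+1)` is the successor and `f (i-1)` the
predecessor of `f i` on `C`). -/
def IsCycleEmbedding {V : Type*} (G : SimpleGraph V) (m : ℕ) (f : ZMod m → V) : Prop :=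
  3 ≤ m ∧ Function.Injective f ∧ ∀ i : ZMod m, G.Adj (f i) (f (i + 1))

/-- `f` describes a longest cycle of `G` (of length `m`). -/
def IsLongestCycle {V : Type*} (G : SimpleGraph V) (m : ℕ) (f : ZMod m → V) : Prop :=
  IsCycleEmbedding G m f ∧
  ∀ (u : V) (C : G.Walk u u), C.IsCycle → C.length ≤ m

/-- `R` is a connected component of `G - V(C)`, where `C` is the cycle given
by `f`: `R` is a nonempty set of vertices off `C`, connected in the induced
subgraph, and closed under adjacency to vertices off `C`. -/
def IsComponentOutside {V : Type*} (G : SimpleGraph V) (m : ℕ) (f : ZMod m → V)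
    (R : Set V) : Prop :=
  R.Nonempty ∧ (∀ x ∈ R, x ∉ Set.range f) ∧ (G.induce R).Connected ∧
  ∀ x ∈ R, ∀ y : V, G.Adj x y → y ∉ Set.range f → y ∈ R

namespace SimpleGraph

variable {V : Type*} {G : SimpleGraph V}

theorem isChain_adj_reverse {l : List V} (h : l.IsChain G.Adj) : l.reverse.IsChain G.Adj :=
  List.isChain_reverse.2 (h.imp fun _ _ hab => hab.symm)

/-- A path, given by its list of vertices, whose ends are adjacent closes up to a cycle. -/
theorem exists_isCycle_of_isChain {l : List V} (hl : l.IsChain G.Adj) (hnd : l.Nodup)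
    (hlen : 3 ≤ l.length) (hclose : ∀ x ∈ l.getLast?, ∀ y ∈ l.head?, G.Adj x y) :
    ∃ (u : V) (C : G.Walk u u), C.IsCycle ∧ C.length = l.length := by
  have hne : l ≠ [] := by rintro rfl; simp at hlen
  have hadj : G.Adj (l.getLast hne) (l.head hne) :=
    hclose _ (List.getLast?_eq_some_getLast hne) _ (List.head?_eq_some_head hne)
  have hp : (Walk.ofSupport l hne hl).IsPath := by
    rw [Walk.isPath_def, Walk.support_ofSupport]
    exact hnd
  refine ⟨_, Walk.cons hadj (Walk.ofSupport l hne hl), ?_, ?_⟩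
  · refine (Walk.cons_isCycle_iff _ _).2 ⟨hp, fun hmem => ?_⟩
    have hpen := hp.eq_penultimate_of_mem_edges hmem
    have h0 := hp.getVert_injOn (x₁ := 0) (x₂ := (Walk.ofSupport l hne hl).length - 1)
      (by simp) (by simp) (by simpa [Walk.penultimate] using hpen)
    rw [Walk.length_ofSupport] at h0
    omega
  · rw [Walk.length_cons, Walk.length_ofSupport]
    omega

/-- The crossing-chords argument: reversing a final segment of a path closes it up to a cycle. -/
theorem exists_isCycle_of_crossing {l : List V} (hl : l.IsChain G.Adj) (hnd : l.Nodup)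
    (hlen : 3 ≤ l.length) (t : ℕ) (ht : t + 1 < l.length)
    (hw : G.Adj (l[l.length - 1]) (l[t])) (hu : G.Adj (l[0]) (l[t + 1])) :
    ∃ (u : V) (C : G.Walk u u), C.IsCycle ∧ C.length = l.length := by
  have hperm : (l.take (t + 1) ++ (l.drop (t + 1)).reverse).Perm l := by
    conv_rhs => rw [← List.take_append_drop (t + 1) l]
    exact (List.reverse_perm _).append_left _
  rw [← hperm.length_eq]
  refine exists_isCycle_of_isChain ?_ (hperm.nodup_iff.2 hnd) (hperm.length_eq ▸ hlen) ?_
  · refine List.isChain_append.2 ⟨hl.take _, isChain_adj_reverse (hl.drop _), ?_⟩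
    intro x hx y hy
    have hxe : x = l[t] := by
      rw [List.getLast?_take, if_neg (by omega), Nat.add_sub_cancel,
        List.getElem?_eq_getElem (by omega)] at hx
      exact (Option.some.inj hx).symm
    have hye : y = l[l.length - 1] := by
      rw [List.head?_reverse, List.getLast?_drop, if_neg (by omega), List.getLast?_eq_getElem?,
        List.getElem?_eq_getElem (by omega)] at hy
      exact (Option.some.inj hy).symm
    rw [hxe, hye]
    exact hw.symm
  · intro x hx y hy
    have hxe : x = l[t + 1] := by
      rw [List.getLast?_append, List.getLast?_reverse, List.head?_drop,
        List.getElem?_eq_getElem ht] at hx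
      exact (Option.some.inj hx).symm
    have hye : y = l[0] := by
      rw [List.head?_append, List.head?_take, if_neg (by omega), List.head?_eq_getElem?,
        List.getElem?_eq_getElem (by omega)] at hy
      exact (Option.some.inj hy).symm
    rw [hxe, hye]
    exact hu.symm

/-- The ends of a path with more vertices than any cycle do not form an Ore-edge. -/
theorem not_oreEdge_of_isChain [Fintype V] [DecidableRel G.Adj] {m : ℕ}
    (hmax : ∀ (u : V) (C : G.Walk u u), C.IsCycle → C.length ≤ m)
    {l : List V} (hl : l.IsChain G.Adj) (hnd : l.Nodup) (hlen : 3 ≤ l.length)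
    (hm : m < l.length) {u w : V} (hu : l.head? = some u) (hw : l.getLast? = some w) :
    ¬OreEdge G u w := by
  classical
  have hu0 : l[0] = u := by
    rw [List.head?_eq_getElem?, List.getElem?_eq_getElem (by omega)] at hu
    exact Option.some.inj hu
  have hw0 : l[l.length - 1] = w := by grind
  rintro ⟨-, hadj | hdeg⟩
  · obtain ⟨v, C, hC, hCl⟩ := exists_isCycle_of_isChain hl hnd hlen (by
      intro x hx y hy
      rw [hw] at hx
      rw [hu] at hy
      cases hx
      cases hy
      exact hadj.symm)
    exact absurd (hmax v C hC) (by omega)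
  have hout : ∀ x ∉ l, G.Adj u x → ¬G.Adj w x := by
    intro x hx hux hwx
    obtain ⟨v, C, hC, hCl⟩ := exists_isCycle_of_isChain (l := x :: l)
      (List.isChain_cons.2 ⟨by grind [hux.symm], hl⟩) (List.nodup_cons.2 ⟨hx, hnd⟩)
      (by simp; omega) (by
        intro a ha b hb
        have ha' : a = w := by grind
        have hb' : b = x := by grind
        rw [ha', hb']
        exact hwx)
    simp only [List.length_cons] at hCl
    exact absurd (hmax v C hC) (by omega)
  set S := (Finset.range (l.length - 1)).filter fun t => ∃ x ∈ l[t + 1]?, G.Adj u x with hS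
  set T := (Finset.range (l.length - 1)).filter fun t => ∃ x ∈ l[t]?, G.Adj w x with hT
  have hST : S.card + T.card ≤ l.length - 1 := by
    rw [← Finset.card_union_of_disjoint]
    · conv_rhs => rw [← Finset.card_range (l.length - 1)]
      exact Finset.card_le_card
        (Finset.union_subset (Finset.filter_subset _ _) (Finset.filter_subset _ _))
    · rw [Finset.disjoint_left]
      intro t ht ht'
      simp only [hS, hT, Finset.mem_filter, Finset.mem_range] at ht ht'
      obtain ⟨ht0, x, hx, hux⟩ := ht
      obtain ⟨-, y, hy, hwy⟩ := ht'
      obtain ⟨v, C, hC, hCl⟩ := exists_isCycle_of_crossing hl hnd hlen t (by omega)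
        (by grind) (by grind)
      exact absurd (hmax v C hC) (by omega)
  have hNu : (G.neighborFinset u ∩ l.toFinset).card ≤ S.card := by
    refine (Finset.card_le_card (t := S.image fun t => l.getD (t + 1) u) ?_).trans
      Finset.card_image_le
    intro x hx
    simp only [Finset.mem_inter, mem_neighborFinset, List.mem_toFinset] at hx
    obtain ⟨hux, hx⟩ := hx
    obtain ⟨k, hk, rfl⟩ := List.mem_iff_getElem.1 hx
    have hk0 : k ≠ 0 := by
      rintro rfl
      exact hux.ne hu0.symm
    obtain ⟨t, rfl⟩ := Nat.exists_eq_succ_of_ne_zero hk0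
    refine Finset.mem_image.2 ⟨t, ?_, by grind⟩
    simp only [hS, Finset.mem_filter, Finset.mem_range]
    exact ⟨by omega, l[t + 1], by simp, hux⟩
  have hNw : (G.neighborFinset w ∩ l.toFinset).card ≤ T.card := by
    refine (Finset.card_le_card (t := T.image fun t => l.getD t w) ?_).trans
      Finset.card_image_le
    intro x hx
    simp only [Finset.mem_inter, mem_neighborFinset, List.mem_toFinset] at hx
    obtain ⟨hwx, hx⟩ := hx
    obtain ⟨k, hk, rfl⟩ := List.mem_iff_getElem.1 hx
    have hk0 : k ≠ l.length - 1 := by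
      rintro rfl
      exact hwx.ne hw0.symm
    refine Finset.mem_image.2 ⟨k, ?_, by grind⟩
    simp only [hT, Finset.mem_filter, Finset.mem_range]
    exact ⟨by omega, l[k], by simp, hwx⟩
  have hOut : (G.neighborFinset u \ l.toFinset).card + (G.neighborFinset w \ l.toFinset).card
      + l.length ≤ Fintype.card V := by
    rw [← List.toFinset_card_of_nodup hnd, ← Finset.card_union_of_disjoint,
      ← Finset.card_union_of_disjoint]
    · exact Finset.card_le_univ _
    · rw [Finset.disjoint_left]
      grind
    · rw [Finset.disjoint_left]
      intro x hx hx'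
      simp only [Finset.mem_sdiff, mem_neighborFinset, List.mem_toFinset] at hx hx'
      exact hout x hx.2 hx.1 hx'.1
  have hdu := Finset.card_inter_add_card_sdiff (G.neighborFinset u) l.toFinset
  have hdw := Finset.card_inter_add_card_sdiff (G.neighborFinset w) l.toFinset
  rw [card_neighborFinset_eq_degree] at hdu hdw
  omega

/-- Two vertices with neighbours in a connected set are joined by a path through that set. -/
theorem exists_isChain_of_induce_connected {R : Set V} (hR : (G.induce R).Connected)
    {a b : V} (ha : ∃ x ∈ R, G.Adj a x) (hb : ∃ x ∈ R, G.Adj b x) :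
    ∃ p : List V, p ≠ [] ∧ p.IsChain G.Adj ∧ p.Nodup ∧ (∀ x ∈ p, x ∈ R) ∧
      (∀ x ∈ p.head?, G.Adj a x) ∧ ∀ x ∈ p.getLast?, G.Adj x b := by
  classical
  obtain ⟨x, hx, hax⟩ := ha
  obtain ⟨y, hy, hby⟩ := hb
  obtain ⟨q, hq⟩ := (hR.preconnected ⟨x, hx⟩ ⟨y, hy⟩).exists_isPath
  refine ⟨q.support.map Subtype.val, List.map_eq_nil_iff.not.2 q.support_ne_nil, ?_, ?_, by grind, ?_, ?_⟩
  · exact List.isChain_map_of_isChain (R := (G.induce R).Adj) Subtype.val (fun _ _ h => h) q.isChain_adj_support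
  · exact hq.support_nodup.map Subtype.val_injective
  · intro z hz
    rw [List.head?_map, List.head?_eq_some_head q.support_ne_nil, q.head_support] at hz
    cases hz
    exact hax
  · intro z hz
    rw [List.getLast?_map, List.getLast?_eq_some_getLast q.support_ne_nil,
      q.getLast_support] at hz
    cases hz
    exact hby.symm

end SimpleGraph

theorem IsLongestCycle.comp_neg {V : Type*} {G : SimpleGraph V} {m : ℕ} {f : ZMod m → V}
    (hC : IsLongestCycle G m f) : IsLongestCycle G m fun k => f (-k) := by
  obtain ⟨⟨hm, hinj, hadj⟩, hmax⟩ := hC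
  refine ⟨⟨hm, hinj.comp neg_injective, fun k => ?_⟩, hmax⟩
  have h := (hadj (-(k + 1))).symm
  rwa [show -(k + 1) + 1 = -k by ring] at h

/-- The successors on a longest cycle of two vertices attached to a connected set off the cycle
do not form an Ore-edge. -/
theorem IsLongestCycle.not_oreEdge_succ {V : Type*} [Fintype V] {G : SimpleGraph V}
    [DecidableRel G.Adj] {m : ℕ} {f : ZMod m → V} (hC : IsLongestCycle G m f) {R : Set V}
    (hRf : ∀ x ∈ R, x ∉ Set.range f) (hR : (G.induce R).Connected) {i j : ZMod m} (hij : i ≠ j)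
    (hi : ∃ x ∈ R, G.Adj (f i) x) (hj : ∃ x ∈ R, G.Adj (f j) x) :
    ¬OreEdge G (f (i + 1)) (f (j + 1)) := by
  obtain ⟨⟨hm, hinj, hadj⟩, hmax⟩ := hC
  have : NeZero m := ⟨by omega⟩
  obtain ⟨p, hpne, hpc, hpnd, hpR, hph, hpl⟩ := exists_isChain_of_induce_connected hR hj hi
  set d := (j - i).val with hd
  have hdm : d < m := ZMod.val_lt _
  have hd0 : 0 < d := by
    rw [Nat.pos_iff_ne_zero, hd, Ne, ZMod.val_eq_zero, sub_eq_zero]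
    exact hij.symm
  have hjd : (d : ZMod m) = j - i := ZMod.natCast_zmod_val _
  set g : ℕ → V := fun s => f (i + 1 + (s : ZMod m)) with hg
  have hgd : g d = f (j + 1) := by simp only [hg, hjd]; congr 1; ring
  have hgd' : g (d - 1) = f j := by
    simp only [hg, Nat.cast_sub (show 1 ≤ d from hd0), hjd]; congr 1; push_cast; ring
  have hgm : g (m - 1) = f i := by
    simp only [hg, Nat.cast_sub (show 1 ≤ m by omega)]; congr 1; simp
  set L := (List.range m).map g with hL
  have hLlen : L.length = m := by simp [hL]
  have hLc : L.IsChain G.Adj := by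
    rw [hL, List.isChain_map]
    refine (List.isChain_range _ _).2 fun s _ => ?_
    have h := hadj (i + 1 + s)
    simpa only [hg, Nat.cast_succ, add_assoc] using h
  have hLnd : L.Nodup := by
    refine List.Nodup.map_on (fun s hs t ht hst => ?_) List.nodup_range
    have hst' : (s : ZMod m) = t := add_left_cancel (hinj hst)
    rw [ZMod.natCast_eq_natCast_iff'] at hst'
    rwa [Nat.mod_eq_of_lt (List.mem_range.1 hs), Nat.mod_eq_of_lt (List.mem_range.1 ht)] at hst'
  have hLp : p.Disjoint L := by
    intro x hx hxL
    obtain ⟨s, -, rfl⟩ := List.mem_map.1 hxL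
    exact hRf _ (hpR _ hx) ⟨_, rfl⟩
  have hLget : ∀ s < m, L[s]? = some (g s) := fun s hs => by simp [hL, hs]
  have hperm : (L.take d ++ (p ++ (L.drop d).reverse)).Perm (p ++ L) := by
    refine List.perm_append_comm_assoc _ _ _ |>.trans (List.Perm.append_left _ ?_)
    conv_rhs => rw [← List.take_append_drop d L]
    exact (List.reverse_perm _).append_left _
  have hplen : 0 < p.length := List.length_pos_of_ne_nil hpne
  have hlast : (L.take d).getLast? = some (f j) := by
    rw [List.getLast?_take, if_neg hd0.ne', hLget _ (by omega), hgd']; rfl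
  have hlast' : (L.drop d).getLast? = some (f i) := by
    rw [List.getLast?_drop, if_neg (by omega), List.getLast?_eq_getElem?, hLlen,
      hLget _ (by omega), hgm]
  have hhead : (L.drop d).head? = some (f (j + 1)) := by
    rw [List.head?_drop, hLget d hdm, hgd]
  have hhead' : (L.take d).head? = some (f (i + 1)) := by
    rw [List.head?_take, if_neg hd0.ne', List.head?_eq_getElem?, hLget 0 (by omega)]
    simp [hg]
  refine not_oreEdge_of_isChain hmax (l := L.take d ++ (p ++ (L.drop d).reverse)) ?_
    (hperm.nodup_iff.2 (hpnd.append hLnd hLp)) ?_ ?_ ?_ ?_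
  · refine List.isChain_append.2 ⟨hLc.take _, List.isChain_append.2
      ⟨hpc, isChain_adj_reverse (hLc.drop _), ?_⟩, ?_⟩
    · intro x hx y hy
      rw [List.head?_reverse, hlast'] at hy
      cases hy
      exact hpl x hx
    · intro x hx y hy
      rw [hlast] at hx
      cases hx
      rw [List.head?_append_of_ne_nil _ hpne] at hy
      exact hph y hy
  · rw [hperm.length_eq, List.length_append]; omega
  · rw [hperm.length_eq, List.length_append]; omega
  · rw [List.head?_append, hhead']; rfl
  · rw [List.getLast?_append, List.getLast?_append, List.getLast?_reverse, hhead]; rfl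

/-- **Lemma 3(b) of the paper.** `G` non-Hamiltonian, `C` a longest cycle, `R` a
component of `G - V(C)`. For distinct vertices `f i`, `f j` of `C` having
neighbors in `R`, neither `{(f i)⁻, (f j)⁻}` nor `{(f i)⁺, (f j)⁺}` is an
Ore-edge. -/
theorem lemma3b {V : Type*} [Fintype V] [DecidableEq V]
    (G : SimpleGraph V) [DecidableRel G.Adj]
    (hnh : ¬G.IsHamiltonian)
    (m : ℕ) (f : ZMod m → V) (hC : IsLongestCycle G m f)
    (R : Set V) (hR : IsComponentOutside G m f R)
    (i j : ZMod m) (hij : i ≠ j)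
    (hi : ∃ x ∈ R, G.Adj (f i) x) (hj : ∃ x ∈ R, G.Adj (f j) x) :
    ¬OreEdge G (f (i - 1)) (f (j - 1)) ∧ ¬OreEdge G (f (i + 1)) (f (j + 1)) := by
  obtain ⟨-, hRf, hRc, -⟩ := hR
  refine ⟨?_, hC.not_oreEdge_succ hRf hRc hij hi hj⟩
  have h := hC.comp_neg.not_oreEdge_succ (R := R) (i := -i) (j := -j)
    (fun x hx ⟨k, hk⟩ => hRf x hx ⟨-k, hk⟩) hRc (neg_injective.ne hij)
    (by simpa using hi) (by simpa using hj)
  simpa only [neg_add, neg_neg, ← sub_eq_add_neg] using h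
end
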